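/- arXiv:1905.13558 — 4 statements merged into one kernel-verified Lean document; each statement's English description precedes it below -/
import Mathlib

section
/- Every subgroup of finite index n in the group π₁(G₃) = ℤ² ⋊ ℤ (where the generator of ℤ acts on ℤ² by the order-3 automorphism ℓ : (x,y) ↦ (−y, x−y)) is isomorphic, as a group, either to π₁(G₃) itself or to ℤ³. -/
open scoped Classical

noncomputable section

/-- `θ(n)`: number of pairs `(p,q)` with `p > 0`, `q ≥ 0`, `p² − pq + q² = n`. -/
def theta (n : ℕ) : ℕ :=
  Nat.card {pq : ℤ × ℤ // 0 < pq.1 ∧ 0 ≤ pq.2 ∧ pq.1 ^ 2 - pq.1 * pq.2 + pq.2 ^ 2 = (n : ℤ)}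

/-- `σ₁(n)`: sum of positive divisors of `n`. -/
def sigma1 (n : ℕ) : ℕ := ∑ d ∈ n.divisors, d

/-- `σ₂(n) = Σ_{k ∣ n} σ₁(k)`. -/
def sigma2 (n : ℕ) : ℕ := ∑ k ∈ n.divisors, sigma1 k

/-- `ω(n) = Σ_{k ∣ n} k·σ₁(k)`. -/
def omegaFn (n : ℕ) : ℕ := ∑ k ∈ n.divisors, k * sigma1 k

/-- The order-3 automorphism `ℓ : (x,y) ↦ (−y, x−y)` of `ℤ²`. -/
def ellG3 : (ℤ × ℤ) ≃+ (ℤ × ℤ) where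
  toFun p := (-p.2, p.1 - p.2)
  invFun p := (p.2 - p.1, -p.1)
  left_inv p := by simp [Prod.ext_iff]
  right_inv p := by simp [Prod.ext_iff]
  map_add' p q := by simp [Prod.ext_iff]; constructor <;> ring

/-- The order-6 automorphism `(x,y) ↦ (x−y, x)` of `ℤ²`. -/
def ellG5 : (ℤ × ℤ) ≃+ (ℤ × ℤ) where
  toFun p := (p.1 - p.2, p.1)
  invFun p := (p.2, p.2 - p.1)
  left_inv p := by simp [Prod.ext_iff]
  right_inv p := by simp [Prod.ext_iff]
  map_add' p q := by simp [Prod.ext_iff]; ring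

/-- The order-2 automorphism `(x,y) ↦ (−x, −y)` of `ℤ²`. -/
def ellG2 : (ℤ × ℤ) ≃+ (ℤ × ℤ) where
  toFun p := (-p.1, -p.2)
  invFun p := (-p.1, -p.2)
  left_inv p := by simp [Prod.ext_iff]
  right_inv p := by simp [Prod.ext_iff]
  map_add' p q := by simp [Prod.ext_iff]; constructor <;> ring

/-- The action of `ℤ` on `ℤ²` generated by `ℓ = ellG3`. -/
def phiG3 : Multiplicative ℤ →* MulAut (Multiplicative (ℤ × ℤ)) :=
  zpowersHom _ (AddEquiv.toMultiplicative ellG3)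

def phiG5 : Multiplicative ℤ →* MulAut (Multiplicative (ℤ × ℤ)) :=
  zpowersHom _ (AddEquiv.toMultiplicative ellG5)

def phiG2 : Multiplicative ℤ →* MulAut (Multiplicative (ℤ × ℤ)) :=
  zpowersHom _ (AddEquiv.toMultiplicative ellG2)

/-- `π₁(G₃) = ℤ² ⋊ ℤ`, the generator of `ℤ` acting by `ℓ : (x,y) ↦ (−y, x−y)`. -/
abbrev PiG3 : Type := Multiplicative (ℤ × ℤ) ⋊[phiG3] Multiplicative ℤ

/-- `π₁(G₅) = ℤ² ⋊ ℤ`, the generator of `ℤ` acting by `(x,y) ↦ (x−y, x)`. -/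
abbrev PiG5 : Type := Multiplicative (ℤ × ℤ) ⋊[phiG5] Multiplicative ℤ

/-- `π₁(G₂) = ℤ² ⋊ ℤ`, the generator of `ℤ` acting by `(x,y) ↦ (−x, −y)`. -/
abbrev PiG2 : Type := Multiplicative (ℤ × ℤ) ⋊[phiG2] Multiplicative ℤ

/-- `ℤ³`, written multiplicatively. -/
abbrev Z3 : Type := Multiplicative (ℤ × ℤ × ℤ)

/-- The number of conjugacy classes of subgroups of `G` satisfying a property `P`
(invariant under conjugation). -/
def numConjClasses (G : Type*) [Group G] (P : Subgroup G → Prop) : ℕ :=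
  Nat.card (Quot (fun H K : {H : Subgroup G // P H} =>
    ∃ g : G, Subgroup.map (MulAut.conj g).toMonoidHom H.val = K.val))

/-- Conjugation acts on an abelian normal factor only through the quotient. -/
theorem SemidirectProduct.mul_inl_mul_inv {A G : Type*} [CommGroup A] [Group G] {φ : G →* MulAut A}
    (h : A ⋊[φ] G) (x : A) : h * inl x * h⁻¹ = inl (φ h.right x) := by
  ext1
  · simp [mul_comm]
  · simp

/-- A subgroup `H` of `A ⋊[φ] ℤ` that splits over its image in `ℤ` via `h` is isomorphic to
`N ⋊[ψ] ℤ`, as soon as `e` identifies `N` equivariantly with `H ∩ A`. -/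
theorem SemidirectProduct.nonempty_mulEquiv_subgroup {A N : Type*} [CommGroup A] [Group N]
    {φ : Multiplicative ℤ →* MulAut A} {ψ : Multiplicative ℤ →* MulAut N}
    (H : Subgroup (A ⋊[φ] Multiplicative ℤ)) (e : N →* A) (he : Function.Injective e)
    (hrange : e.range = H.comap inl) (h : A ⋊[φ] Multiplicative ℤ) (hh : h ∈ H)
    (hright : h.right ≠ 1) (hmap : H.map rightHom ≤ Subgroup.zpowers h.right)
    (hequiv : ∀ (m : ℤ) (x : N), e (ψ (Multiplicative.ofAdd m) x) = φ (h.right ^ m) (e x)) :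
    Nonempty (H ≃* (N ⋊[ψ] Multiplicative ℤ)) := by
  have hzr (m : ℤ) : (h ^ m).right = h.right ^ m := map_zpow rightHom h m
  let f : N ⋊[ψ] Multiplicative ℤ →* A ⋊[φ] Multiplicative ℤ :=
    lift (inl.comp e) (zpowersHom _ h) (by
      intro g
      refine MonoidHom.ext fun x => ?_
      have hx := hequiv g.toAdd x
      rw [ofAdd_toAdd, ← hzr] at hx
      exact (congrArg inl hx).trans (mul_inl_mul_inv _ _).symm)
  have hf (x) : f x = inl (e x.left) * h ^ (x.right.toAdd) := by
    simp [f, lift]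
  have hmem (x : N) : inl (e x) ∈ H := by
    have : e x ∈ H.comap inl := hrange ▸ ⟨x, rfl⟩
    exact this
  have hinj : Function.Injective f := by
    rw [injective_iff_map_eq_one]
    intro x hx
    rw [hf] at hx
    have hr : h.right ^ x.right.toAdd = 1 := by
      simpa [hzr] using congrArg right hx
    have hx0 : x.right.toAdd = 0 := by
      have := congrArg Multiplicative.toAdd hr
      rw [toAdd_zpow] at this
      rcases smul_eq_zero.1 this with h0 | h0
      · exact h0
      · exact absurd h0 hright
    have hl : e x.left = 1 := by
      rw [hx0] at hx
      simpa using congrArg left hx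
    ext1
    · exact he (by simpa using hl)
    · exact hx0
  have hrg : f.range = H := by
    apply le_antisymm
    · rintro _ ⟨x, rfl⟩
      rw [hf]
      exact mul_mem (hmem _) (zpow_mem hh _)
    · intro y hy
      obtain ⟨m, hm⟩ := hmap ⟨y, hy, rfl⟩
      have hm : h.right ^ m = y.right := hm
      have hy1 : (y * (h ^ m)⁻¹).right = 1 := by
        simp [hzr, hm]
      have hy2 : y * (h ^ m)⁻¹ = inl (y * (h ^ m)⁻¹).left := by
        ext1
        · simp
        · simpa using hy1
      have hy3 : (y * (h ^ m)⁻¹).left ∈ e.range := by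
        rw [hrange]
        change inl _ ∈ H
        rw [← hy2]
        exact mul_mem hy (inv_mem (zpow_mem hh _))
      obtain ⟨x, hx⟩ := hy3
      refine ⟨⟨x, Multiplicative.ofAdd m⟩, ?_⟩
      rw [hf]
      simp only [hx, toAdd_ofAdd]
      rw [← hy2]
      simp
  exact ⟨((MonoidHom.ofInjective hinj).trans (MulEquiv.subgroupCongr hrg)).symm⟩

theorem ellG3_three (x : ℤ × ℤ) : ellG3 (ellG3 (ellG3 x)) = x := by
  ext <;> simp only [ellG3, AddEquiv.coe_mk, Equiv.coe_fn_mk] <;> ring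

theorem phiG3_ofAdd_one (x : Multiplicative (ℤ × ℤ)) :
    phiG3 (Multiplicative.ofAdd 1) x = Multiplicative.ofAdd (ellG3 x.toAdd) := by
  simp [phiG3]

theorem phiG3_ofAdd_three_mul (m : ℤ) : phiG3 (Multiplicative.ofAdd (3 * m)) = 1 := by
  have h3 : phiG3 (Multiplicative.ofAdd 3) = 1 := by
    ext1 x
    rw [show (Multiplicative.ofAdd (3 : ℤ)) = Multiplicative.ofAdd (1 : ℤ) *
      Multiplicative.ofAdd (1 : ℤ) * Multiplicative.ofAdd (1 : ℤ) from rfl]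
    simp only [map_mul, MulAut.mul_apply, phiG3_ofAdd_one]
    exact congrArg Multiplicative.ofAdd (ellG3_three x.toAdd)
  rw [mul_comm, ← smul_eq_mul, ofAdd_zsmul, map_zpow, h3, one_zpow]

/-- The norm form of the Eisenstein integers. -/
def eisensteinNorm (u : ℤ × ℤ) : ℤ := u.1 ^ 2 - u.1 * u.2 + u.2 ^ 2

theorem eisensteinNorm_nonneg (u : ℤ × ℤ) : 0 ≤ eisensteinNorm u := by
  unfold eisensteinNorm
  nlinarith [sq_nonneg (u.1 - u.2), sq_nonneg u.1, sq_nonneg u.2]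

theorem eisensteinNorm_pos {u : ℤ × ℤ} (hu : u ≠ 0) : 0 < eisensteinNorm u := by
  refine lt_of_le_of_ne (eisensteinNorm_nonneg u) fun h => hu ?_
  unfold eisensteinNorm at h
  have h1 : u.1 = 0 := by
    nlinarith [sq_nonneg (u.1 - 2 * u.2), sq_nonneg u.1]
  have h2 : u.2 = 0 := by
    nlinarith [sq_nonneg (u.2 - 2 * u.1), sq_nonneg u.2]
  exact Prod.ext h1 h2

/-- Division with remainder in the Eisenstein integers. -/
theorem exists_eisensteinNorm_sub_lt (u w : ℤ × ℤ) (hw : w ≠ 0) :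
    ∃ a b : ℤ, eisensteinNorm (u - (a • w + b • ellG3 w)) < eisensteinNorm w := by
  have hN := eisensteinNorm_pos hw
  obtain ⟨u₁, u₂⟩ := u
  obtain ⟨p, q⟩ := w
  set N := eisensteinNorm (p, q) with hNdef
  have near (x : ℤ) : ∃ a : ℤ, 2 * |x - a * N| ≤ N := by
    refine ⟨(2 * x + N) / (2 * N), ?_⟩
    have h1 := Int.emod_add_mul_ediv (2 * x + N) (2 * N)
    have h2 := Int.emod_nonneg (2 * x + N) (show 2 * N ≠ 0 by omega)
    have h3 := Int.emod_lt_of_pos (2 * x + N) (show 0 < 2 * N by omega)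
    have h4 : |x - (2 * x + N) / (2 * N) * N| * 2 = |2 * (x - (2 * x + N) / (2 * N) * N)| := by
      rw [abs_mul, abs_two, mul_comm]
    rw [mul_comm, h4, abs_le]
    constructor <;> nlinarith
  -- the coordinates of `u` times the conjugate of `w`
  obtain ⟨a, ha⟩ := near (u₁ * (p - q) + u₂ * q)
  obtain ⟨b, hb⟩ := near (u₂ * p - u₁ * q)
  refine ⟨a, b, ?_⟩
  set A := u₁ * (p - q) + u₂ * q - a * N with hA
  set B := u₂ * p - u₁ * q - b * N with hB
  have key : eisensteinNorm ((u₁, u₂) - (a • (p, q) + b • ellG3 (p, q))) * N =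
      A ^ 2 - A * B + B ^ 2 := by
    simp only [hA, hB, hNdef, eisensteinNorm, ellG3, AddEquiv.coe_mk, Equiv.coe_fn_mk,
      Prod.smul_mk, smul_eq_mul, Prod.mk_add_mk, Prod.mk_sub_mk]
    ring
  have hAB : 4 * (A ^ 2 - A * B + B ^ 2) ≤ 3 * N ^ 2 := by
    have h1 : (2 * |A|) ^ 2 ≤ N ^ 2 := pow_le_pow_left₀ (by positivity) ha 2
    have h2 : (2 * |B|) ^ 2 ≤ N ^ 2 := pow_le_pow_left₀ (by positivity) hb 2
    have h3 : (2 * |A|) * (2 * |B|) ≤ N * N := mul_le_mul ha hb (by positivity) hN.le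
    have h4 := neg_abs_le (A * B)
    rw [abs_mul] at h4
    rw [mul_pow, sq_abs] at h1 h2
    nlinarith
  by_contra! hc
  nlinarith [mul_le_mul_of_nonneg_right hc hN.le, mul_pos hN hN]

/-- The Eisenstein integers form a principal ideal domain: a nonzero `ellG3`-stable subgroup
is generated by a single vector and its image. -/
theorem exists_generator_of_ellG3_stable (L : AddSubgroup (ℤ × ℤ)) (hL : L ≠ ⊥)
    (hstab : ∀ x ∈ L, ellG3 x ∈ L) :
    ∃ w ∈ L, w ≠ 0 ∧ ∀ u ∈ L, ∃ a b : ℤ, u = a • w + b • ellG3 w := by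
  obtain ⟨v, hv, hv0⟩ := L.ne_bot_iff_exists_ne_zero.1 hL |>.elim
    fun v hv => (⟨v.1, v.2, fun h => hv (Subtype.ext h)⟩ : ∃ v ∈ L, v ≠ 0)
  obtain ⟨w, ⟨hw, hw0⟩, hmin⟩ := exists_minimalFor_of_wellFoundedLT
    (fun v => v ∈ L ∧ v ≠ 0) (fun v => (eisensteinNorm v).toNat) ⟨v, hv, hv0⟩
  refine ⟨w, hw, hw0, fun u hu => ?_⟩
  obtain ⟨a, b, hab⟩ := exists_eisensteinNorm_sub_lt u w hw0
  refine ⟨a, b, sub_eq_zero.1 (by_contra fun hr => ?_)⟩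
  have hrL : u - (a • w + b • ellG3 w) ∈ L :=
    sub_mem hu (add_mem (zsmul_mem hw a) (zsmul_mem (hstab w hw) b))
  have h1 := eisensteinNorm_pos hr
  have h2 := eisensteinNorm_pos hw0
  have := hmin ⟨hrL, hr⟩
  simp only at this
  omega

theorem eisenstein_lincomb_injective {w : ℤ × ℤ} (hw : w ≠ 0) {a b : ℤ}
    (h : a • w + b • ellG3 w = 0) : a = 0 ∧ b = 0 := by
  have hN := eisensteinNorm_pos hw
  obtain ⟨p, q⟩ := w
  simp only [ellG3, AddEquiv.coe_mk, Equiv.coe_fn_mk, Prod.smul_mk, smul_eq_mul, Prod.mk_add_mk,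
    Prod.mk_eq_zero] at h
  obtain ⟨h1, h2⟩ := h
  simp only [eisensteinNorm] at hN
  constructor
  · refine (mul_eq_zero.1 (?_ : a * (p ^ 2 - p * q + q ^ 2) = 0)).resolve_right hN.ne'
    linear_combination (p - q) * h1 + q * h2
  · refine (mul_eq_zero.1 (?_ : b * (p ^ 2 - p * q + q ^ 2) = 0)).resolve_right hN.ne'
    linear_combination (-q) * h1 + p * h2

/-- A nonzero `ellG3`-stable subgroup of `ℤ²` is `ellG3`-equivariantly isomorphic to `ℤ²`. -/
theorem exists_equivariant_parametrization (L : AddSubgroup (ℤ × ℤ)) (hL : L ≠ ⊥)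
    (hstab : ∀ x ∈ L, ellG3 x ∈ L) :
    ∃ e : ℤ × ℤ →+ ℤ × ℤ, Function.Injective e ∧ e.range = L ∧
      ∀ x, e (ellG3 x) = ellG3 (e x) := by
  obtain ⟨w, hw, hw0, hgen⟩ := exists_generator_of_ellG3_stable L hL hstab
  refine ⟨⟨⟨fun x => x.1 • w + x.2 • ellG3 w, by simp⟩, fun x y => ?_⟩, ?_, ?_, fun x => ?_⟩
  · simp only [Prod.fst_add, Prod.snd_add, add_smul]
    abel
  · rw [injective_iff_map_eq_zero]
    intro x hx
    obtain ⟨h1, h2⟩ := eisenstein_lincomb_injective hw0 hx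
    exact Prod.ext h1 h2
  · ext u
    constructor
    · rintro ⟨x, rfl⟩
      exact add_mem (zsmul_mem hw _) (zsmul_mem (hstab w hw) _)
    · intro hu
      obtain ⟨a, b, rfl⟩ := hgen u hu
      exact ⟨(a, b), rfl⟩
  · ext <;> simp [ellG3] <;> ring

/-- A finite-index subgroup of `ℤ²` is isomorphic to `ℤ²`. -/
theorem exists_parametrization (L : AddSubgroup (ℤ × ℤ)) [L.FiniteIndex] :
    ∃ e : ℤ × ℤ →+ ℤ × ℤ, Function.Injective e ∧ e.range = L := by
  have hr : Module.finrank ℤ (ℤ × ℤ) = Module.finrank ℤ L :=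
    (AddSubgroup.finrank_eq_of_finiteIndex L).symm
  let f := LinearEquiv.ofFinrankEq (ℤ × ℤ) L hr
  refine ⟨L.subtype.comp f.toAddEquiv.toAddMonoidHom, ?_, ?_⟩
  · exact Subtype.val_injective.comp f.injective
  · ext u
    constructor
    · rintro ⟨x, rfl⟩
      exact (f x).2
    · intro hu
      obtain ⟨x, hx⟩ := f.surjective ⟨u, hu⟩
      exact ⟨x, congrArg Subtype.val hx⟩

/-- Every finite-index subgroup contains an element generating its image in `ℤ`, and this
element can be chosen with exponent congruent to `0` or `1` modulo `3`. -/
theorem exists_mem_right_generator (H : Subgroup PiG3) (hH : H.index ≠ 0) :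
    ∃ h ∈ H, h.right ≠ 1 ∧ H.map SemidirectProduct.rightHom ≤ Subgroup.zpowers h.right ∧
      ∃ m : ℤ, h.right.toAdd = 3 * m ∨ h.right.toAdd = 3 * m + 1 := by
  obtain ⟨g, hg⟩ := (Subgroup.isCyclic_iff_exists_zpowers_eq_top
    (H.map (SemidirectProduct.rightHom : PiG3 →* _))).1 inferInstance
  obtain ⟨h, hh, rfl⟩ : g ∈ H.map (SemidirectProduct.rightHom : PiG3 →* _) :=
    hg ▸ Subgroup.mem_zpowers g
  change Subgroup.zpowers h.right = _ at hg
  have hne : h.right ≠ 1 := by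
    intro h1
    obtain ⟨k, hk, -, hkH⟩ := Subgroup.exists_pow_mem_of_index_ne_zero hH
      (SemidirectProduct.inr (Multiplicative.ofAdd 1) : PiG3)
    have hmem : (Multiplicative.ofAdd (1 : ℤ)) ^ k ∈ Subgroup.zpowers h.right := by
      rw [hg]
      exact ⟨_, hkH, by rw [map_pow, SemidirectProduct.rightHom_inr]⟩
    rw [h1, Subgroup.zpowers_one_eq_bot, Subgroup.mem_bot, ← ofAdd_nsmul, ofAdd_eq_one] at hmem
    simp at hmem
    omega
  have hcases : ∃ m : ℤ, h.right.toAdd = 3 * m ∨ h.right.toAdd = 3 * m + 1 ∨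
      -h.right.toAdd = 3 * m + 1 := by
    have : h.right.toAdd % 3 = 0 ∨ h.right.toAdd % 3 = 1 ∨ (-h.right.toAdd) % 3 = 1 := by omega
    rcases this with h0 | h0 | h0
    · exact ⟨h.right.toAdd / 3, by omega⟩
    · exact ⟨h.right.toAdd / 3, by omega⟩
    · exact ⟨(-h.right.toAdd) / 3, by omega⟩
  obtain ⟨m, h0 | h0 | h0⟩ := hcases
  · exact ⟨h, hh, hne, hg.ge, m, .inl h0⟩
  · exact ⟨h, hh, hne, hg.ge, m, .inr h0⟩
  · refine ⟨h⁻¹, inv_mem hh, ?_, ?_, m, .inr ?_⟩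
    · simpa using hne
    · rw [SemidirectProduct.inv_right, Subgroup.zpowers_inv]
      exact hg.ge
    · simpa using h0

theorem ellG3_mem_of_phiG3_right {H : Subgroup PiG3} {h : PiG3} (hh : h ∈ H)
    (hphi : phiG3 h.right = phiG3 (Multiplicative.ofAdd 1)) {x : ℤ × ℤ}
    (hx : (SemidirectProduct.inl (Multiplicative.ofAdd x) : PiG3) ∈ H) :
    (SemidirectProduct.inl (Multiplicative.ofAdd (ellG3 x)) : PiG3) ∈ H := by
  have heq : (SemidirectProduct.inl (Multiplicative.ofAdd (ellG3 x)) : PiG3) =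
      h * SemidirectProduct.inl (Multiplicative.ofAdd x) * h⁻¹ := by
    rw [SemidirectProduct.mul_inl_mul_inv, hphi, phiG3_ofAdd_one, toAdd_ofAdd]
  rw [heq]
  exact mul_mem (mul_mem hh hx) (inv_mem hh)

theorem phiG3_equivariant {e : ℤ × ℤ →+ ℤ × ℤ} (he : ∀ x, e (ellG3 x) = ellG3 (e x)) (m : ℤ)
    (x : Multiplicative (ℤ × ℤ)) :
    e.toMultiplicative (phiG3 (Multiplicative.ofAdd m) x) =
      phiG3 (Multiplicative.ofAdd m) (e.toMultiplicative x) := by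
  have hone (y : Multiplicative (ℤ × ℤ)) : e.toMultiplicative (phiG3 (Multiplicative.ofAdd 1) y) =
      phiG3 (Multiplicative.ofAdd 1) (e.toMultiplicative y) := by
    rw [phiG3_ofAdd_one, phiG3_ofAdd_one]
    exact congrArg Multiplicative.ofAdd (he y.toAdd)
  have hsucc (k : ℤ) (y : Multiplicative (ℤ × ℤ)) : phiG3 (Multiplicative.ofAdd (k + 1)) y =
      phiG3 (Multiplicative.ofAdd 1) (phiG3 (Multiplicative.ofAdd k) y) := by
    rw [add_comm, ofAdd_add, map_mul, MulAut.mul_apply]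
  induction m with
  | zero => simp
  | succ n ih => rw [hsucc, hsucc, hone, ih]
  | pred n ih =>
    apply (phiG3 (Multiplicative.ofAdd 1)).injective
    rw [← hone, ← hsucc, ← hsucc, sub_add_cancel, ih]

/-- every finite-index subgroup of `π₁(G₃)` is isomorphic to
`π₁(G₃)` or to `ℤ³`. -/
theorem stmt0 (n : ℕ) (hn : 0 < n) (H : Subgroup PiG3) (hH : H.index = n) :
    Nonempty (H ≃* PiG3) ∨ Nonempty (H ≃* Z3) := by
  have hidx : H.index ≠ 0 := by omega
  have : H.FiniteIndex := ⟨hidx⟩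
  obtain ⟨h, hh, hne, hmap, m, hm | hm⟩ := exists_mem_right_generator H hidx
  · right
    have : (H.comap SemidirectProduct.inl).FiniteIndex := ⟨by
      rw [Subgroup.index_comap]
      exact Subgroup.FiniteIndex.index_ne_zero⟩
    have : (Subgroup.toAddSubgroup' (H.comap SemidirectProduct.inl)).FiniteIndex :=
      AddSubgroup.finiteIndex_toSubgroup_iff _ |>.1 this
    obtain ⟨e, he, hrange⟩ :=
      exists_parametrization (Subgroup.toAddSubgroup' (H.comap SemidirectProduct.inl))
    have hphi : phiG3 h.right = 1 := by
      rw [← ofAdd_toAdd h.right, hm, phiG3_ofAdd_three_mul]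
    obtain ⟨E⟩ := SemidirectProduct.nonempty_mulEquiv_subgroup (ψ := 1) H e.toMultiplicative he
      (by ext x; exact SetLike.ext_iff.1 hrange x.toAdd) h hh hne hmap
      (fun k x => by simp [map_zpow, hphi])
    exact ⟨E.trans (SemidirectProduct.mulEquivProd.trans
      ((MulEquiv.prodMultiplicative _ _).symm.trans AddEquiv.prodAssoc.toMultiplicative))⟩
  · left
    have hphi : phiG3 h.right = phiG3 (Multiplicative.ofAdd 1) := by
      rw [← ofAdd_toAdd h.right, hm, ofAdd_add, map_mul, phiG3_ofAdd_three_mul, one_mul]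
    obtain ⟨e, he, hrange, heq⟩ := exists_equivariant_parametrization
      (Subgroup.toAddSubgroup' (H.comap SemidirectProduct.inl))
      (by
        intro hbot
        obtain ⟨k, hk, -, hkH⟩ := Subgroup.exists_pow_mem_of_index_ne_zero hidx
          (SemidirectProduct.inl (Multiplicative.ofAdd (1, 0)) : PiG3)
        have hmem : k • ((1, 0) : ℤ × ℤ) ∈
            Subgroup.toAddSubgroup' (H.comap SemidirectProduct.inl) := by
          rw [← map_pow] at hkH
          exact hkH
        rw [hbot, AddSubgroup.mem_bot] at hmem
        simp at hmem
        omega)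
      (fun x hx => ellG3_mem_of_phiG3_right hh hphi hx)
    refine SemidirectProduct.nonempty_mulEquiv_subgroup H e.toMultiplicative he
      (by ext x; exact SetLike.ext_iff.1 hrange x.toAdd) h hh hne hmap (fun k x => ?_)
    rw [phiG3_equivariant heq, map_zpow, hphi, ← map_zpow, ← ofAdd_zsmul, smul_eq_mul, mul_one]
end
end

section
/- For every positive integer n, the number of subgroups of index n in π₁(G₅) that are isomorphic to π₁(G₂) equals ω(n/3) − ω(n/6), where ω(n/m) is 0 when m does not divide n. -/
open scoped Classical

noncomputable section

open SemidirectProduct Multiplicative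

theorem sum_divisors_filter_dvd (F : ℕ → ℕ) {n m : ℕ} (hn : 0 < n) (hm : 0 < m) :
    ∑ a ∈ n.divisors with m ∣ a, F (n / a) =
      if m ∣ n then ∑ k ∈ (n / m).divisors, F k else 0 := by
  split_ifs with h
  · obtain ⟨q, rfl⟩ := h
    rw [Nat.mul_div_cancel_left _ hm, ← Nat.sum_div_divisors]
    symm
    refine Finset.sum_bij (fun b _ => m * b) ?_ ?_ ?_ ?_
    · intro b hb
      simp only [Finset.mem_filter, Nat.mem_divisors] at hb ⊢
      exact ⟨⟨mul_dvd_mul_left m hb.1, hn.ne'⟩, dvd_mul_right _ _⟩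
    · intro b _ b' _ h
      exact Nat.eq_of_mul_eq_mul_left hm h
    · intro a ha
      simp only [Finset.mem_filter, Nat.mem_divisors] at ha
      obtain ⟨⟨ha, -⟩, b, rfl⟩ := ha
      refine ⟨b, ?_, rfl⟩
      rw [Nat.mem_divisors]
      exact ⟨Nat.dvd_of_mul_dvd_mul_left hm ha, fun h => by simp [h] at hn⟩
    · intro b _
      rw [Nat.mul_div_mul_left _ _ hm]
  · refine Finset.sum_eq_zero fun a ha => ?_
    simp only [Finset.mem_filter, Nat.mem_divisors] at ha
    exact absurd (ha.2.trans ha.1.1) h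

theorem sum_divisors_filter_mod_six (F : ℕ → ℕ) {n : ℕ} (hn : 0 < n) :
    ∑ a ∈ n.divisors with a % 6 = 3, F (n / a) +
        (if 6 ∣ n then ∑ k ∈ (n / 6).divisors, F k else 0) =
      if 3 ∣ n then ∑ k ∈ (n / 3).divisors, F k else 0 := by
  rw [← sum_divisors_filter_dvd F hn (by norm_num), ← sum_divisors_filter_dvd F hn (by norm_num),
    ← Finset.sum_union]
  · refine Finset.sum_congr ?_ fun _ _ => rfl
    ext a
    simp only [Finset.mem_union, Finset.mem_filter, ← and_or_left]
    exact and_congr_right fun _ => by omega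
  · rw [Finset.disjoint_filter]
    intro a _ h
    omega

/-- The index of a subgroup is multiplicative along a short exact sequence. -/
@[to_additive]
theorem index_eq_index_map_mul_index_comap {N G Q : Type*} [Group N] [Group G] [Group Q]
    (f : N →* G) (g : G →* Q) (hfg : f.range = g.ker) (hg : Function.Surjective g)
    (H : Subgroup G) : H.index = (H.map g).index * (H.comap f).index := by
  have key : H.relIndex g.ker = H.relIndex (H ⊔ g.ker) := by
    refine Nat.card_eq_of_bijective (Subgroup.quotientSubgroupOfEmbeddingOfLE H le_sup_right) ⟨?_, ?_⟩
    · exact Function.Embedding.injective _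
    · intro q
      induction q using QuotientGroup.induction_on with
      | H x =>
        obtain ⟨x, hx⟩ := x
        rw [sup_comm] at hx
        obtain ⟨n, hn, h, hh, rfl⟩ := Subgroup.mem_sup_of_normal_left.mp hx
        refine ⟨QuotientGroup.mk ⟨n, hn⟩, ?_⟩
        erw [QuotientGroup.eq]
        simpa [Subgroup.mem_subgroupOf] using hh
  rw [Subgroup.index_map, Subgroup.index_comap, hfg, key, MonoidHom.range_eq_top.mpr hg,
    Subgroup.index_top, mul_one, mul_comm]
  exact (Subgroup.relIndex_mul_index le_sup_left).symm

theorem phiG2_even {k : ℤ} (hk : Even k) (v : Multiplicative (ℤ × ℤ)) :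
    phiG2 (ofAdd k) v = v := by
  have h2 : (AddEquiv.toMultiplicative ellG2 : MulAut (Multiplicative (ℤ × ℤ))) ^ (2 : ℤ) = 1 := by
    ext v : 1
    change ofAdd (ellG2 (ellG2 v.toAdd)) = v
    simp [ellG2]
  obtain ⟨j, rfl⟩ := hk
  rw [← two_mul, phiG2, zpowersHom_apply, toAdd_ofAdd, zpow_mul, h2, one_zpow]
  rfl

theorem phiG2_odd {k : ℤ} (hk : ¬ Even k) (v : Multiplicative (ℤ × ℤ)) :
    phiG2 (ofAdd k) v = v⁻¹ := by
  obtain ⟨j, rfl⟩ := Int.not_even_iff_odd.mp hk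
  rw [ofAdd_add, map_mul, MulAut.mul_apply, phiG2_even (even_two_mul j)]
  rfl

theorem phiG5_six_dvd {k : ℤ} (hk : 6 ∣ k) (v : Multiplicative (ℤ × ℤ)) :
    phiG5 (ofAdd k) v = v := by
  have h6 : (AddEquiv.toMultiplicative ellG5 : MulAut (Multiplicative (ℤ × ℤ))) ^ (6 : ℤ) = 1 := by
    ext v : 1
    change ofAdd (ellG5 (ellG5 (ellG5 (ellG5 (ellG5 (ellG5 v.toAdd)))))) = v
    simp [ellG5]
  obtain ⟨j, rfl⟩ := hk
  rw [phiG5, zpowersHom_apply, toAdd_ofAdd, zpow_mul, h6, one_zpow]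
  rfl

theorem phiG5_three {k : ℤ} (hk : k % 6 = 3) (v : Multiplicative (ℤ × ℤ)) :
    phiG5 (ofAdd k) v = v⁻¹ := by
  obtain ⟨j, rfl⟩ : ∃ j, k = 6 * j + 3 := ⟨k / 6, by omega⟩
  rw [ofAdd_add, map_mul, MulAut.mul_apply, phiG5_six_dvd (dvd_mul_right 6 j)]
  change ofAdd (ellG5 (ellG5 (ellG5 v.toAdd))) = v⁻¹
  apply toAdd.injective
  ext
  · simp [ellG5]
    ring
  · simp [ellG5]

theorem phiG5_two {k : ℤ} (hk : k % 6 = 2) (v : ℤ × ℤ) :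
    phiG5 (ofAdd k) (ofAdd v) = ofAdd (-v.2, v.1 - v.2) := by
  obtain ⟨j, rfl⟩ : ∃ j, k = 6 * j + 2 := ⟨k / 6, by omega⟩
  rw [ofAdd_add, map_mul, MulAut.mul_apply, phiG5_six_dvd (dvd_mul_right 6 j)]
  change ofAdd (ellG5 (ellG5 v)) = _
  simp [ellG5]

theorem phiG5_four {k : ℤ} (hk : k % 6 = 4) (v : ℤ × ℤ) :
    phiG5 (ofAdd k) (ofAdd v) = ofAdd (v.2 - v.1, - v.1) := by
  obtain ⟨j, rfl⟩ : ∃ j, k = 6 * j + 4 := ⟨k / 6, by omega⟩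
  rw [ofAdd_add, map_mul, MulAut.mul_apply, phiG5_six_dvd (dvd_mul_right 6 j)]
  change ofAdd (ellG5 (ellG5 (ellG5 (ellG5 v)))) = _
  simp only [ellG5, AddEquiv.coe_mk, Equiv.coe_fn_mk]
  congr 2 <;> ring


theorem AddSubgroup.mem_iff_index_dvd (S : AddSubgroup ℤ) (x : ℤ) : x ∈ S ↔ (S.index : ℤ) ∣ x := by
  obtain ⟨a, rfl⟩ := Int.subgroup_cyclic S
  rw [← AddSubgroup.zmultiples_eq_closure, Int.index_zmultiples, Int.mem_zmultiples_iff,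
    Int.natAbs_dvd]

/-- The intersection of a subgroup of `PiG5` with the normal subgroup `ℤ²`. -/
def lattice (H : Subgroup PiG5) : AddSubgroup (ℤ × ℤ) :=
  Subgroup.toAddSubgroup' (H.comap inl)

theorem mem_lattice {H : Subgroup PiG5} {v : ℤ × ℤ} :
    v ∈ lattice H ↔ (inl (ofAdd v) : PiG5) ∈ H := Iff.rfl

/-- The index in `ℤ` of the projection of a subgroup of `PiG5`. -/
def rightIndex (H : Subgroup PiG5) : ℕ :=
  (Subgroup.toAddSubgroup' (H.map rightHom)).index

/-- The index in `ℤ` of the first projection of the lattice of a subgroup of `PiG5`. -/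
def fstIndex (H : Subgroup PiG5) : ℕ :=
  ((lattice H).map (AddMonoidHom.fst ℤ ℤ)).index

/-- The index in `ℤ` of the intersection of the lattice of a subgroup of `PiG5` with `0 × ℤ`. -/
def sndIndex (H : Subgroup PiG5) : ℕ :=
  ((lattice H).comap (AddMonoidHom.inr ℤ ℤ)).index

theorem index_eq_rightIndex_mul (H : Subgroup PiG5) :
    H.index = rightIndex H * (fstIndex H * sndIndex H) := by
  rw [index_eq_index_map_mul_index_comap inl rightHom range_inl_eq_ker_rightHom
    rightHom_surjective H]
  congr 1
  refine index_eq_index_map_add_index_comap (AddMonoidHom.inr ℤ ℤ) (AddMonoidHom.fst ℤ ℤ)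
    ?_ Prod.fst_surjective (lattice H)
  ext ⟨x, y⟩
  change (∃ z, ((0 : ℤ), z) = (x, y)) ↔ x = 0
  simp [eq_comm]

theorem rightIndex_dvd {H : Subgroup PiG5} {k : ℤ} :
    (rightIndex H : ℤ) ∣ k ↔ ∃ v : ℤ × ℤ, (⟨ofAdd v, ofAdd k⟩ : PiG5) ∈ H := by
  rw [rightIndex, ← AddSubgroup.mem_iff_index_dvd]
  constructor
  · rintro ⟨⟨v, _⟩, hg, rfl⟩
    exact ⟨v.toAdd, hg⟩
  · rintro ⟨v, hv⟩
    exact ⟨_, hv, rfl⟩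

theorem fstIndex_dvd {H : Subgroup PiG5} {x : ℤ} :
    (fstIndex H : ℤ) ∣ x ↔ ∃ y : ℤ, (x, y) ∈ lattice H := by
  rw [fstIndex, ← AddSubgroup.mem_iff_index_dvd]
  constructor
  · rintro ⟨⟨_, y⟩, hg, rfl⟩
    exact ⟨y, hg⟩
  · rintro ⟨v, hv⟩
    exact ⟨_, hv, rfl⟩

theorem sndIndex_dvd {H : Subgroup PiG5} {y : ℤ} :
    (sndIndex H : ℤ) ∣ y ↔ (0, y) ∈ lattice H := by
  rw [sndIndex, ← AddSubgroup.mem_iff_index_dvd]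
  rfl

/-- A subgroup of finite index in `PiG5` isomorphic to `PiG2` has projection generated by an odd
multiple of `3`. -/
theorem rightIndex_mod_six {H : Subgroup PiG5} (hH : H.index ≠ 0) (f : H ≃* PiG2) :
    rightIndex H % 6 = 3 := by
  have hcomm : ∀ x y : H, x ^ 2 * y ^ 2 = y ^ 2 * x ^ 2 := by
    have key : ∀ x y : PiG2, x ^ 2 * y ^ 2 = y ^ 2 * x ^ 2 := by
      rintro ⟨v, k⟩ ⟨w, l⟩
      obtain ⟨k, rfl⟩ := ofAdd.surjective k
      obtain ⟨l, rfl⟩ := ofAdd.surjective l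
      simp only [pow_two]
      ext1
      · simp only [mul_left, mul_right, ← ofAdd_add, phiG2_even ⟨k, rfl⟩, phiG2_even ⟨l, rfl⟩]
        exact mul_comm _ _
      · exact mul_comm _ _
    intro x y
    apply f.injective
    simpa using key (f x) (f y)
  have hnc : ∃ x y : H, x * y ≠ y * x := by
    by_contra! h
    have h1 := h (f.symm (inl (ofAdd (1, 0)))) (f.symm (inr (ofAdd 1)))
    rw [← map_mul, ← map_mul] at h1
    have h2 := congrArg (fun g : PiG2 => g.left.toAdd.1) (f.symm.injective h1)
    simp [phiG2_odd (k := 1) (by decide)] at h2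
  rw [index_eq_rightIndex_mul] at hH
  set d := sndIndex H with hd
  have hd0 : d ≠ 0 := fun h => hH (by rw [h]; simp)
  obtain ⟨v, hv⟩ := rightIndex_dvd.mp (dvd_refl (rightIndex H : ℤ))
  have hl : (0, (d : ℤ)) ∈ lattice H := sndIndex_dvd.mp (dvd_refl _)
  have hfix : phiG5 (ofAdd (rightIndex H + rightIndex H : ℤ)) (ofAdd (0, (d + d : ℤ))) =
      ofAdd (0, (d + d : ℤ)) := by
    have h := congrArg (fun g : H => g.1.left) (hcomm ⟨_, hv⟩ ⟨_, hl⟩)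
    simp only [pow_two, Subgroup.coe_mul, mul_left, mul_right, ← ofAdd_add, left_inl, right_inl,
      map_one, MulAut.one_apply, mul_one] at h
    exact mul_left_cancel (h.trans (mul_comm _ _))
  have h3 : rightIndex H % 3 = 0 := by
    by_contra h3
    rcases (show (rightIndex H + rightIndex H : ℤ) % 6 = 2 ∨
      (rightIndex H + rightIndex H : ℤ) % 6 = 4 by omega) with h | h
    · rw [phiG5_two h] at hfix
      have := congrArg Prod.fst (ofAdd.injective hfix)
      simp only at this
      omega
    · rw [phiG5_four h] at hfix
      have := congrArg Prod.fst (ofAdd.injective hfix)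
      simp only at this
      omega
  by_contra h6
  obtain ⟨⟨⟨x, k⟩, hx⟩, ⟨⟨y, l⟩, hy⟩, hxy⟩ := hnc
  have h6' : ∀ {k : ℤ}, (rightIndex H : ℤ) ∣ k → 6 ∣ k := fun h =>
    dvd_trans (by omega) h
  refine hxy (Subtype.ext ?_)
  have hk := phiG5_six_dvd (h6' (rightIndex_dvd.mpr ⟨x.toAdd, hx⟩))
  have hl := phiG5_six_dvd (h6' (rightIndex_dvd.mpr ⟨y.toAdd, hy⟩))
  ext1
  · change x * phiG5 k y = y * phiG5 l x
    erw [hk, hl]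
    exact mul_comm _ _
  · exact mul_comm _ _

theorem six_dvd_mul_of_even {a k : ℤ} (ha : a % 6 = 3) (hk : Even k) : 6 ∣ a * k := by
  obtain ⟨j, rfl⟩ := hk
  exact ⟨(2 * (a / 6) + 1) * j, by
    linear_combination -2 * j * Int.emod_add_mul_ediv a 6 + 2 * j * ha⟩

theorem mul_emod_six_of_not_even {a k : ℤ} (ha : a % 6 = 3) (hk : ¬ Even k) :
    a * k % 6 = 3 := by
  rw [Int.not_even_iff_odd] at hk
  obtain ⟨j, rfl⟩ := hk
  have h := six_dvd_mul_of_even ha (even_two_mul j)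
  rw [mul_add, mul_one]
  omega

/-- The embedding of `PiG2` in `PiG5` with lattice spanned by `(c, e)` and `(0, d)`, sending the
generator of `ℤ` to `((u, w), a)`. -/
def embedding (a c d e u w : ℤ) (ha : a % 6 = 3) : PiG2 →* PiG5 :=
  MonoidHom.mk' (fun g =>
    ⟨ofAdd (c * g.left.toAdd.1 + if Even g.right.toAdd then 0 else u,
      e * g.left.toAdd.1 + d * g.left.toAdd.2 + if Even g.right.toAdd then 0 else w),
      ofAdd (a * g.right.toAdd)⟩) <| by
  rintro ⟨v, k⟩ ⟨v', k'⟩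
  obtain ⟨k, rfl⟩ := ofAdd.surjective k
  obtain ⟨k', rfl⟩ := ofAdd.surjective k'
  ext1
  · apply toAdd.injective
    simp only [mul_left, mul_right, toAdd_mul, toAdd_ofAdd]
    by_cases hk : Even k
    · rw [phiG2_even hk, phiG5_six_dvd (six_dvd_mul_of_even ha hk)]
      by_cases hk' : Even k' <;> simp [hk, hk', Int.even_add] <;> constructor <;> ring
    · rw [phiG2_odd hk, phiG5_three (mul_emod_six_of_not_even ha hk)]
      by_cases hk' : Even k' <;> simp [hk, hk', Int.even_add] <;> constructor <;> ring
  · exact toAdd.injective (mul_add a k k')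

section embedding

variable {a c d e u w : ℤ} (ha : a % 6 = 3)

theorem embedding_injective (hc : c ≠ 0) (hd : d ≠ 0) :
    Function.Injective (embedding a c d e u w ha) := by
  rw [injective_iff_map_eq_one]
  rintro ⟨v, k⟩ h
  obtain ⟨k, rfl⟩ := ofAdd.surjective k
  obtain ⟨⟨x, y⟩, rfl⟩ := ofAdd.surjective v
  have hk : a * k = 0 := congrArg (fun g : PiG5 => g.right.toAdd) h
  obtain rfl : k = 0 := by
    rcases mul_eq_zero.mp hk with h | h
    · omega
    · exact h
  have hx : c * x + 0 = 0 := congrArg (fun g : PiG5 => g.left.toAdd.1) h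
  obtain rfl : x = 0 := by simpa [hc] using hx
  have hy : e * 0 + d * y + 0 = 0 := congrArg (fun g : PiG5 => g.left.toAdd.2) h
  obtain rfl : y = 0 := by simpa [hd] using hy
  rfl

theorem mem_range_embedding {x y k : ℤ} :
    (⟨ofAdd (x, y), ofAdd k⟩ : PiG5) ∈ (embedding a c d e u w ha).range ↔
      ∃ r s j : ℤ, c * r + (if Even j then 0 else u) = x ∧
        e * r + d * s + (if Even j then 0 else w) = y ∧ a * j = k := by
  constructor
  · rintro ⟨⟨v, j⟩, h⟩
    exact ⟨v.toAdd.1, v.toAdd.2, j.toAdd, congrArg (fun g : PiG5 => g.left.toAdd.1) h,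
      congrArg (fun g : PiG5 => g.left.toAdd.2) h, congrArg (fun g : PiG5 => g.right.toAdd) h⟩
  · rintro ⟨r, s, j, rfl, rfl, rfl⟩
    exact ⟨⟨ofAdd (r, s), ofAdd j⟩, rfl⟩

theorem mem_lattice_range_embedding {x y : ℤ} :
    (x, y) ∈ lattice (embedding a c d e u w ha).range ↔
      ∃ r s : ℤ, c * r = x ∧ e * r + d * s = y := by
  refine (mem_range_embedding ha (k := 0)).trans ?_
  constructor
  · rintro ⟨r, s, j, rfl, rfl, h⟩
    obtain rfl : j = 0 := by
      rcases mul_eq_zero.mp h with h | h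
      · omega
      · exact h
    exact ⟨r, s, by simp, by simp⟩
  · rintro ⟨r, s, rfl, rfl⟩
    exact ⟨r, s, 0, by simp, by simp, by simp⟩

theorem range_embedding_le {H : Subgroup PiG5} (h₁ : (c, e) ∈ lattice H) (h₂ : (0, d) ∈ lattice H)
    (h₃ : (⟨ofAdd (u, w), ofAdd a⟩ : PiG5) ∈ H) : (embedding a c d e u w ha).range ≤ H := by
  rintro _ ⟨g, rfl⟩
  have hl : ∀ x y : ℤ, embedding a c d e u w ha (inl (ofAdd (x, y))) ∈ H := by
    intro x y
    convert mem_lattice.mp (add_mem (zsmul_mem h₁ x) (zsmul_mem h₂ y)) using 1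
    ext1
    · apply toAdd.injective
      simp [embedding, mul_comm]
    · simp [embedding]
  have hr : embedding a c d e u w ha (inr (ofAdd 1)) ∈ H := by
    convert h₃ using 1
    ext1
    · apply toAdd.injective
      simp [embedding]
    · simp [embedding]
  rw [← inl_left_mul_inr_right g, map_mul]
  refine mul_mem (hl _ _) ?_
  have : g.right = ofAdd 1 ^ g.right.toAdd := by
    rw [← ofAdd_zsmul, smul_eq_mul, mul_one, ofAdd_toAdd]
  rw [this, map_zpow, map_zpow]
  exact zpow_mem hr _

end embedding

theorem nat_eq_of_forall_dvd_iff {a b : ℕ} (h : ∀ x : ℤ, (a : ℤ) ∣ x ↔ (b : ℤ) ∣ x) : a = b :=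
  Nat.dvd_antisymm (Int.natCast_dvd_natCast.mp ((h b).mpr dvd_rfl))
    (Int.natCast_dvd_natCast.mp ((h a).mp dvd_rfl))

section embedding

variable {a c d : ℕ} {e u w : ℤ} (ha : (a : ℤ) % 6 = 3)

theorem rightIndex_range_embedding : rightIndex (embedding a c d e u w ha).range = a := by
  refine nat_eq_of_forall_dvd_iff fun k => rightIndex_dvd.trans ⟨?_, ?_⟩
  · rintro ⟨⟨x, y⟩, h⟩
    obtain ⟨-, -, j, -, -, rfl⟩ := (mem_range_embedding ha).mp h
    exact dvd_mul_right _ _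
  · rintro ⟨j, rfl⟩
    exact ⟨_, (mem_range_embedding ha).mpr ⟨0, 0, j, rfl, rfl, rfl⟩⟩

theorem fstIndex_range_embedding : fstIndex (embedding a c d e u w ha).range = c := by
  refine nat_eq_of_forall_dvd_iff fun x => fstIndex_dvd.trans ⟨?_, ?_⟩
  · rintro ⟨y, h⟩
    obtain ⟨r, -, rfl, -⟩ := (mem_lattice_range_embedding ha).mp h
    exact dvd_mul_right _ _
  · rintro ⟨j, rfl⟩
    exact ⟨_, (mem_lattice_range_embedding ha).mpr ⟨j, 0, rfl, rfl⟩⟩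

theorem sndIndex_range_embedding (hc : c ≠ 0) :
    sndIndex (embedding a c d e u w ha).range = d := by
  refine nat_eq_of_forall_dvd_iff fun x => sndIndex_dvd.trans ?_
  rw [mem_lattice_range_embedding ha]
  constructor
  · rintro ⟨r, s, hr, rfl⟩
    obtain rfl : r = 0 := by simpa [hc] using hr
    simp
  · rintro ⟨j, rfl⟩
    exact ⟨0, j, by simp, by simp⟩

theorem index_range_embedding (hc : c ≠ 0) :
    (embedding a c d e u w ha).range.index = a * (c * d) := by
  rw [index_eq_rightIndex_mul, rightIndex_range_embedding, fstIndex_range_embedding,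
    sndIndex_range_embedding ha hc]

end embedding

theorem nat_eq_of_lt_of_dvd_sub {m x y : ℕ} (hx : x < m) (hy : y < m)
    (h : (m : ℤ) ∣ (x : ℤ) - y) : x = y := by
  exact ((Nat.modEq_iff_dvd.mpr h).eq_of_lt_of_lt hy hx).symm

/-- The parameters `(a, (c, d), e, u, w)` of the embeddings of `PiG2` in `PiG5` with image of
index `n`, normalized so as to be determined by that image. -/
def parameters (n : ℕ) : Finset (Σ _ : ℕ, Σ _ : ℕ × ℕ, ℕ × ℕ × ℕ) :=
  (n.divisors.filter (· % 6 = 3)).sigma fun a =>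
    (n / a).divisorsAntidiagonal.sigma fun cd =>
      Finset.range cd.2 ×ˢ (Finset.range cd.1 ×ˢ Finset.range cd.2)

theorem card_parameters (n : ℕ) :
    (parameters n).card = ∑ a ∈ n.divisors with a % 6 = 3, n / a * sigma1 (n / a) := by
  rw [parameters, Finset.card_sigma]
  refine Finset.sum_congr rfl fun a _ => ?_
  rw [Finset.card_sigma, sigma1, ← Nat.sum_divisorsAntidiagonal' (f := fun _ d => d), Finset.mul_sum]
  refine Finset.sum_congr rfl fun cd hcd => ?_
  rw [← (Nat.mem_divisorsAntidiagonal.mp hcd).1]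
  simp only [Finset.card_product, Finset.card_range]
  ring

theorem mem_parameters {n a c d e u w : ℕ} (hn : 0 < n) :
    (⟨a, (c, d), e, u, w⟩ : Σ _ : ℕ, Σ _ : ℕ × ℕ, ℕ × ℕ × ℕ) ∈ parameters n ↔
      a * (c * d) = n ∧ a % 6 = 3 ∧ e < d ∧ u < c ∧ w < d := by
  simp only [parameters, Finset.mem_sigma, Finset.mem_filter, Nat.mem_divisors,
    Nat.mem_divisorsAntidiagonal, Finset.mem_product, Finset.mem_range]
  constructor
  · rintro ⟨⟨⟨h, -⟩, h6⟩, ⟨h', -⟩, h₁, h₂, h₃⟩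
    exact ⟨by rw [h', Nat.mul_div_cancel' h], h6, h₁, h₂, h₃⟩
  · rintro ⟨rfl, h6, h₁, h₂, h₃⟩
    have ha : 0 < a := by omega
    rw [Nat.mul_div_cancel_left _ ha]
    exact ⟨⟨⟨dvd_mul_right _ _, hn.ne'⟩, h6⟩, ⟨rfl, (Nat.pos_of_mul_pos_left hn).ne'⟩,
      h₁, h₂, h₃⟩

theorem range_embedding_inj {a c d e u w a' c' d' e' u' w' : ℕ}
    (ha : (a : ℤ) % 6 = 3) (ha' : (a' : ℤ) % 6 = 3)
    (he : e < d) (hu : u < c) (hw : w < d) (he' : e' < d') (hu' : u' < c') (hw' : w' < d')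
    (h : (embedding a c d e u w ha).range = (embedding a' c' d' e' u' w' ha').range) :
    a = a' ∧ c = c' ∧ d = d' ∧ e = e' ∧ u = u' ∧ w = w' := by
  have h₁ := congrArg rightIndex h
  rw [rightIndex_range_embedding, rightIndex_range_embedding] at h₁
  have h₂ := congrArg fstIndex h
  rw [fstIndex_range_embedding, fstIndex_range_embedding] at h₂
  have h₃ := congrArg sndIndex h
  rw [sndIndex_range_embedding ha (by omega), sndIndex_range_embedding ha' (by omega)] at h₃
  subst h₁ h₂ h₃
  have hc : (c : ℤ) ≠ 0 := by omega
  refine ⟨rfl, rfl, rfl, ?_⟩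
  constructor
  · have : ((c : ℤ), (e : ℤ)) ∈ lattice (embedding a c d e u w ha).range :=
      (mem_lattice_range_embedding ha).mpr ⟨1, 0, by simp, by simp⟩
    rw [h] at this
    obtain ⟨r, s, hr, hs⟩ := (mem_lattice_range_embedding ha).mp this
    obtain rfl : r = 1 := mul_left_cancel₀ hc (hr.trans (mul_one _).symm)
    exact nat_eq_of_lt_of_dvd_sub he he' ⟨s, by linear_combination -hs⟩
  · have : (⟨ofAdd ((u : ℤ), (w : ℤ)), ofAdd (a : ℤ)⟩ : PiG5) ∈
        (embedding a c d e u w ha).range :=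
      (mem_range_embedding ha).mpr ⟨0, 0, 1, by simp, by simp, by simp⟩
    rw [h] at this
    obtain ⟨r, s, j, hr, hs, hj⟩ := (mem_range_embedding ha).mp this
    have ha0 : (a : ℤ) ≠ 0 := by omega
    obtain rfl : j = 1 := mul_left_cancel₀ ha0 (hj.trans (mul_one _).symm)
    rw [if_neg (by decide)] at hr hs
    obtain rfl : u = u' := nat_eq_of_lt_of_dvd_sub hu hu' ⟨r, by linear_combination -hr⟩
    obtain rfl : r = 0 := mul_left_cancel₀ hc (by linear_combination hr)
    exact ⟨rfl, nat_eq_of_lt_of_dvd_sub hw hw' ⟨s, by linear_combination -hs⟩⟩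

theorem exists_emod_eq {d : ℕ} (hd : 0 < d) (x : ℤ) :
    ∃ y < d, ∃ q : ℤ, (y : ℤ) = x - d * q := by
  have h₁ := Int.emod_nonneg x (Int.natCast_ne_zero.mpr hd.ne')
  have h₂ := Int.emod_lt_of_pos x (Int.natCast_pos.mpr hd)
  exact ⟨(x % d).toNat, by omega, x / d, by rw [Int.toNat_of_nonneg h₁, Int.emod_def]⟩

theorem exists_range_embedding_eq {H : Subgroup PiG5} (hH : H.index ≠ 0) (f : H ≃* PiG2) :
    ∃ (a c d e u w : ℕ) (ha : (a : ℤ) % 6 = 3), a * (c * d) = H.index ∧ e < d ∧ u < c ∧ w < d ∧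
      (embedding a c d e u w ha).range = H := by
  have ha : (rightIndex H : ℤ) % 6 = 3 := by exact_mod_cast rightIndex_mod_six hH f
  have hi := index_eq_rightIndex_mul H
  obtain ⟨hc, hd⟩ : 0 < fstIndex H ∧ 0 < sndIndex H := by
    rw [hi] at hH
    simp only [mul_ne_zero_iff] at hH
    omega
  have h₂ : ∀ s : ℤ, (0, sndIndex H * s) ∈ lattice H := fun s =>
    sndIndex_dvd.mp (dvd_mul_right _ _)
  obtain ⟨e₀, he₀⟩ := fstIndex_dvd.mp (dvd_refl (fstIndex H : ℤ))
  obtain ⟨e, he, q, heq⟩ := exists_emod_eq hd e₀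
  have h₁ : ((fstIndex H : ℤ), (e : ℤ)) ∈ lattice H := by
    convert add_mem he₀ (h₂ (-q)) using 1
    ext <;> simp [heq, sub_eq_add_neg]
  obtain ⟨⟨u₀, w₀⟩, h₀⟩ := rightIndex_dvd.mp (dvd_refl (rightIndex H : ℤ))
  obtain ⟨u, hu, r, hur⟩ := exists_emod_eq hc u₀
  obtain ⟨w, hw, s, hws⟩ := exists_emod_eq hd (w₀ - e * r)
  have h₃ : (⟨ofAdd ((u : ℤ), (w : ℤ)), ofAdd (rightIndex H : ℤ)⟩ : PiG5) ∈ H := by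
    convert mul_mem (mem_lattice.mp (add_mem (zsmul_mem h₁ (-r)) (h₂ (-s)))) h₀ using 1
    ext1
    · apply toAdd.injective
      ext
      · simp [hur]
        ring
      · simp [hws]
        ring
    · simp
  refine ⟨rightIndex H, fstIndex H, sndIndex H, e, u, w, ha, hi.symm, he, hu, hw, ?_⟩
  have hle := range_embedding_le ha h₁ (sndIndex_dvd.mp dvd_rfl) h₃
  refine le_antisymm hle (Subgroup.relIndex_eq_one.mp ?_)
  have hmul := Subgroup.relIndex_mul_index hle
  rw [index_range_embedding ha hc.ne', ← hi] at hmul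
  exact Nat.eq_of_mul_eq_mul_right (Nat.pos_of_ne_zero hH) (by rw [hmul, one_mul])

theorem card_subgroups_eq_card_parameters {n : ℕ} (hn : 0 < n) :
    Nat.card {H : Subgroup PiG5 // H.index = n ∧ Nonempty (H ≃* PiG2)} =
      (parameters n).card := by
  have hmem : ∀ p : parameters n, (p.1.1 : ℤ) % 6 = 3 := by
    rintro ⟨⟨a, ⟨c, d⟩, e, u, w⟩, hp⟩
    exact_mod_cast ((mem_parameters hn).mp hp).2.1
  have hsub : ∀ p : parameters n,
      (embedding p.1.1 p.1.2.1.1 p.1.2.1.2 p.1.2.2.1 p.1.2.2.2.1 p.1.2.2.2.2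
        (hmem p)).range.index = n ∧
      Nonempty ((embedding p.1.1 p.1.2.1.1 p.1.2.1.2 p.1.2.2.1 p.1.2.2.2.1 p.1.2.2.2.2
        (hmem p)).range ≃* PiG2) := by
    rintro ⟨⟨a, ⟨c, d⟩, e, u, w⟩, hp⟩
    obtain ⟨h, -, he, hu, hw⟩ := (mem_parameters hn).mp hp
    have hc : c ≠ 0 := by omega
    have hd : d ≠ 0 := by omega
    exact ⟨(index_range_embedding _ hc).trans h, ⟨(MonoidHom.ofInjective
      (embedding_injective _ (Int.natCast_ne_zero.mpr hc) (Int.natCast_ne_zero.mpr hd))).symm⟩⟩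
  rw [← Nat.card_eq_finsetCard]
  symm
  refine Nat.card_eq_of_bijective (fun p => ⟨_, hsub p⟩) ⟨?_, ?_⟩
  · rintro ⟨⟨a, ⟨c, d⟩, e, u, w⟩, hp⟩ ⟨⟨a', ⟨c', d'⟩, e', u', w'⟩, hp'⟩ h
    obtain ⟨-, -, he, hu, hw⟩ := (mem_parameters hn).mp hp
    obtain ⟨-, -, he', hu', hw'⟩ := (mem_parameters hn).mp hp'
    obtain ⟨rfl, rfl, rfl, rfl, rfl, rfl⟩ :=
      range_embedding_inj _ _ he hu hw he' hu' hw' (congrArg Subtype.val h)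
    rfl
  · rintro ⟨H, rfl, ⟨f⟩⟩
    obtain ⟨a, c, d, e, u, w, ha, hi, he, hu, hw, h⟩ := exists_range_embedding_eq hn.ne' f
    exact ⟨⟨⟨a, (c, d), e, u, w⟩, (mem_parameters hn).mpr ⟨hi, by omega, he, hu, hw⟩⟩,
      Subtype.ext h⟩

/-- the number of index-`n` subgroups of `π₁(G₅)` isomorphic to `π₁(G₂)`. -/
theorem stmt8 (n : ℕ) (hn : 0 < n) :
    (Nat.card {H : Subgroup PiG5 // H.index = n ∧ Nonempty (H ≃* PiG2)} : ℤ) =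
      (if 3 ∣ n then (omegaFn (n / 3) : ℤ) else 0) -
        (if 6 ∣ n then (omegaFn (n / 6) : ℤ) else 0) := by
  have h := sum_divisors_filter_mod_six (fun k => k * sigma1 k) hn
  rw [card_subgroups_eq_card_parameters hn, card_parameters, eq_sub_iff_add_eq]
  exact_mod_cast h
end
end

section
/- For every positive integer n, the number of subgroups of index n in π₁(G₅) that are isomorphic to ℤ³ equals ω(n/6), which is 0 when 6 does not divide n. -/
open scoped Classical

noncomputable section

/-- The subgroup of `A × ℤ` meeting `A` in `L`, projecting onto `dℤ`, and whose elements above `d`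
lie in the coset `c` of `L`. -/
def latticeOfCoset {A : Type*} [AddCommGroup A] (L : AddSubgroup A) (d : ℤ) (c : A ⧸ L) :
    AddSubgroup (A × ℤ) where
  carrier := {p | ∃ t : ℤ, p.2 = t * d ∧ (p.1 : A ⧸ L) = t • c}
  zero_mem' := ⟨0, by simp⟩
  add_mem' := by
    rintro p q ⟨t, hp, hp'⟩ ⟨s, hq, hq'⟩
    exact ⟨t + s, by simp [hp, hq, add_mul], by simp [hp', hq', add_smul]⟩
  neg_mem' := by
    rintro p ⟨t, hp, hp'⟩
    exact ⟨-t, by simp [hp], by simp [hp']⟩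

theorem mem_latticeOfCoset {A : Type*} [AddCommGroup A] {L : AddSubgroup A} {d : ℤ} {c : A ⧸ L}
    {p : A × ℤ} :
    p ∈ latticeOfCoset L d c ↔ ∃ t : ℤ, p.2 = t * d ∧ (p.1 : A ⧸ L) = t • c := Iff.rfl

theorem comap_inl_latticeOfCoset {A : Type*} [AddCommGroup A] (L : AddSubgroup A) {d : ℤ}
    (hd : d ≠ 0) (c : A ⧸ L) :
    (latticeOfCoset L d c).comap (AddMonoidHom.inl A ℤ) = L := by
  ext x
  simp only [AddSubgroup.mem_comap, AddMonoidHom.inl_apply, mem_latticeOfCoset]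
  constructor
  · rintro ⟨t, ht, hx⟩
    have : t = 0 := by simpa [hd] using ht.symm
    simpa [this] using hx
  · intro hx
    exact ⟨0, by simp, by simpa using hx⟩

theorem map_snd_latticeOfCoset {A : Type*} [AddCommGroup A] (L : AddSubgroup A) (d : ℤ)
    (c : A ⧸ L) :
    (latticeOfCoset L d c).map (AddMonoidHom.snd A ℤ) = AddSubgroup.zmultiples d := by
  ext k
  simp only [AddSubgroup.mem_map, mem_latticeOfCoset, AddSubgroup.mem_zmultiples_iff]
  constructor
  · rintro ⟨p, ⟨t, ht, -⟩, rfl⟩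
    exact ⟨t, by simp [ht]⟩
  · rintro ⟨t, rfl⟩
    obtain ⟨x, hx⟩ := QuotientAddGroup.mk_surjective (t • c)
    exact ⟨(x, t * d), ⟨t, rfl, hx⟩, by simp⟩

theorem latticeOfCoset_injective {A : Type*} [AddCommGroup A] (L : AddSubgroup A) {d : ℤ}
    (hd : d ≠ 0) : Function.Injective (latticeOfCoset L d) := by
  intro c c' h
  obtain ⟨x, rfl⟩ := QuotientAddGroup.mk_surjective c
  have hx : (x, d) ∈ latticeOfCoset L d (x : A ⧸ L) := ⟨1, by simp, by simp⟩
  rw [h] at hx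
  obtain ⟨t, ht, hx⟩ := hx
  have : t = 1 := by
    apply mul_right_cancel₀ hd
    simpa using ht.symm
  simpa [this] using hx

theorem exists_latticeOfCoset_eq {A : Type*} [AddCommGroup A] (H : AddSubgroup (A × ℤ)) {d : ℤ}
    (hd : H.map (AddMonoidHom.snd A ℤ) = AddSubgroup.zmultiples d) :
    ∃ c, latticeOfCoset (H.comap (AddMonoidHom.inl A ℤ)) d c = H := by
  have hmem : d ∈ H.map (AddMonoidHom.snd A ℤ) := hd ▸ AddSubgroup.mem_zmultiples d
  obtain ⟨⟨v, k⟩, hv, rfl⟩ := hmem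
  refine ⟨(v : A ⧸ _), ?_⟩
  have key (x : A) (t : ℤ) :
      (x : A ⧸ H.comap (AddMonoidHom.inl A ℤ)) = t • (v : A ⧸ _) ↔ (x, t * k) ∈ H := by
    rw [← QuotientAddGroup.mk_zsmul, eq_comm, QuotientAddGroup.eq, AddSubgroup.mem_comap,
      ← H.add_mem_cancel_left (H.zsmul_mem hv t)]
    simp
  ext ⟨x, j⟩
  constructor
  · rintro ⟨t, rfl, hx⟩
    exact (key x t).1 hx
  · intro hx
    have : j ∈ H.map (AddMonoidHom.snd A ℤ) := ⟨_, hx, rfl⟩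
    rw [hd, AddSubgroup.mem_zmultiples_iff] at this
    obtain ⟨t, rfl⟩ := this
    exact ⟨t, by simp, (key x t).2 (by simpa using hx)⟩

theorem index_eq_index_comap_inl_mul_index_map_snd {A : Type*} [AddCommGroup A]
    (H : AddSubgroup (A × ℤ)) :
    H.index = (H.comap (AddMonoidHom.inl A ℤ)).index * (H.map (AddMonoidHom.snd A ℤ)).index := by
  have hker : (AddMonoidHom.inl A ℤ).range = (AddMonoidHom.snd A ℤ).ker := by
    ext ⟨x, k⟩
    simp only [AddMonoidHom.mem_ker, AddMonoidHom.mem_range, AddMonoidHom.inl_apply,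
      AddMonoidHom.coe_snd, Prod.mk.injEq]
    simp [eq_comm]
  have hrange : (AddMonoidHom.snd A ℤ).range = ⊤ :=
    AddMonoidHom.range_eq_top.2 fun k => ⟨(0, k), rfl⟩
  rw [AddSubgroup.index_map, AddSubgroup.index_comap, hker, hrange, AddSubgroup.index_top, mul_one,
    ← AddSubgroup.relIndex_sup_right, sup_comm, AddSubgroup.relIndex_mul_index le_sup_left]

theorem int_addSubgroup_eq_zmultiples_index (K : AddSubgroup ℤ) :
    K = AddSubgroup.zmultiples (K.index : ℤ) := by
  obtain ⟨a, rfl⟩ := Int.subgroup_cyclic K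
  rw [← AddSubgroup.zmultiples_eq_closure, Int.index_zmultiples]
  ext; simp [Int.mem_zmultiples_iff]

theorem card_addSubgroup_int_index {m : ℕ} :
    Nat.card {L : AddSubgroup ℤ // L.index = m} = 1 := by
  rw [Nat.card_eq_one_iff_unique]
  refine ⟨⟨fun K L => Subtype.ext ?_⟩, ⟨⟨AddSubgroup.zmultiples (m : ℤ), by
    simp [Int.index_zmultiples]⟩⟩⟩
  rw [int_addSubgroup_eq_zmultiples_index K.1, int_addSubgroup_eq_zmultiples_index L.1, K.2, L.2]

theorem bijective_latticeOfCoset {A : Type*} [AddCommGroup A] {m : ℕ} (hm : 0 < m) :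
    ∃ f : (Σ a : m.divisors, Σ L : {L : AddSubgroup A // L.index = a}, A ⧸ L.1) →
      {H : AddSubgroup (A × ℤ) // H.index = m}, Function.Bijective f := by
  have hdiv (a : m.divisors) : ((m / a.1 : ℕ) : ℤ) ≠ 0 := by
    have := Nat.div_pos (Nat.divisor_le a.2) (Nat.pos_of_mem_divisors a.2)
    omega
  refine ⟨fun p => ⟨latticeOfCoset p.2.1.1 (m / p.1.1 : ℕ) p.2.2, ?_⟩, ?_, ?_⟩
  · rw [index_eq_index_comap_inl_mul_index_map_snd, comap_inl_latticeOfCoset _ (hdiv _),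
      map_snd_latticeOfCoset, Int.index_zmultiples, p.2.1.2, Int.natAbs_natCast]
    exact Nat.mul_div_cancel' (Nat.dvd_of_mem_divisors p.1.2)
  · rintro ⟨⟨a, ha⟩, ⟨L, hL⟩, c⟩ ⟨⟨b, hb⟩, ⟨M, hM⟩, c'⟩ h
    have h' := congrArg Subtype.val h
    have hLM : L = M := by
      rw [← comap_inl_latticeOfCoset L (hdiv ⟨a, ha⟩) c,
        ← comap_inl_latticeOfCoset M (hdiv ⟨b, hb⟩) c']
      exact congrArg _ h'
    dsimp only at hL hM
    subst hLM hL hM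
    obtain rfl := latticeOfCoset_injective L (hdiv ⟨_, ha⟩) h'
    rfl
  · rintro ⟨H, hH⟩
    have hmul := index_eq_index_comap_inl_mul_index_map_snd H
    rw [hH] at hmul
    have hmem : (H.comap (AddMonoidHom.inl A ℤ)).index ∈ m.divisors :=
      Nat.mem_divisors.2 ⟨Dvd.intro _ hmul.symm, hm.ne'⟩
    have hd : m / (H.comap (AddMonoidHom.inl A ℤ)).index = (H.map (AddMonoidHom.snd A ℤ)).index :=
      Nat.div_eq_of_eq_mul_right (Nat.pos_of_mem_divisors hmem) hmul
    obtain ⟨c, hc⟩ := exists_latticeOfCoset_eq H (int_addSubgroup_eq_zmultiples_index _)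
    refine ⟨⟨⟨_, hmem⟩, ⟨_, rfl⟩, c⟩, Subtype.ext ?_⟩
    simp only [hd, hc]

theorem card_addSubgroup_prod_int_index {A : Type*} [AddCommGroup A] {s : ℕ → ℕ}
    (hs : ∀ a, 0 < a → Finite {L : AddSubgroup A // L.index = a} ∧
      Nat.card {L : AddSubgroup A // L.index = a} = s a) {m : ℕ} (hm : 0 < m) :
    Finite {H : AddSubgroup (A × ℤ) // H.index = m} ∧
      Nat.card {H : AddSubgroup (A × ℤ) // H.index = m} = ∑ a ∈ m.divisors, a * s a := by
  obtain ⟨f, hf⟩ := bijective_latticeOfCoset (A := A) hm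
  have hpos (a : m.divisors) : 0 < a.1 := Nat.pos_of_mem_divisors a.2
  have (a : m.divisors) : Finite {L : AddSubgroup A // L.index = a} := (hs a (hpos a)).1
  have (a : m.divisors) (L : {L : AddSubgroup A // L.index = a}) : Finite (A ⧸ L.1) := by
    apply Nat.finite_of_card_ne_zero
    rw [← AddSubgroup.index_eq_card, L.2]
    exact (hpos a).ne'
  refine ⟨Finite.of_surjective f hf.2, ?_⟩
  have (a : m.divisors) : Fintype {L : AddSubgroup A // L.index = a} := Fintype.ofFinite _
  rw [← Nat.card_congr (Equiv.ofBijective f hf), Nat.card_sigma, ← Finset.sum_coe_sort m.divisors]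
  refine Finset.sum_congr rfl fun a _ => ?_
  rw [Nat.card_sigma, ← (hs a (hpos a)).2]
  have (L : {L : AddSubgroup A // L.index = a}) : Nat.card (A ⧸ L.1) = a := by
    rw [← AddSubgroup.index_eq_card, L.2]
  simp [this, mul_comm]

theorem card_addSubgroup_int_cubed_index {m : ℕ} (hm : 0 < m) :
    Nat.card {H : AddSubgroup ((ℤ × ℤ) × ℤ) // H.index = m} = omegaFn m := by
  have h1 (a : ℕ) (_ : 0 < a) : Finite {L : AddSubgroup ℤ // L.index = a} ∧
      Nat.card {L : AddSubgroup ℤ // L.index = a} = (fun _ => 1) a :=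
    ⟨Nat.finite_of_card_ne_zero (by simp [card_addSubgroup_int_index]), card_addSubgroup_int_index⟩
  have h2 (a : ℕ) (ha : 0 < a) : Finite {L : AddSubgroup (ℤ × ℤ) // L.index = a} ∧
      Nat.card {L : AddSubgroup (ℤ × ℤ) // L.index = a} = sigma1 a := by
    simpa [sigma1] using card_addSubgroup_prod_int_index h1 ha
  exact (card_addSubgroup_prod_int_index h2 hm).2

theorem nonempty_mulEquiv_Z3 (L : AddSubgroup ((ℤ × ℤ) × ℤ)) (hL : L.index ≠ 0) :
    Nonempty (AddSubgroup.toSubgroup L ≃* Z3) := by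
  have : L.FiniteIndex := ⟨hL⟩
  have h : Module.finrank ℤ L = Module.finrank ℤ (ℤ × ℤ × ℤ) := by
    rw [AddSubgroup.finrank_eq_of_finiteIndex L]
    simp
  have : Module.Free ℤ L := inferInstanceAs (Module.Free ℤ (AddSubgroup.toIntSubmodule L))
  have : Module.Finite ℤ L := inferInstanceAs (Module.Finite ℤ (AddSubgroup.toIntSubmodule L))
  exact ⟨AddEquiv.toMultiplicative (LinearEquiv.ofFinrankEq L (ℤ × ℤ × ℤ) h).toAddEquiv⟩

theorem ellG5_pow_six :
    (AddEquiv.toMultiplicative ellG5 : MulAut (Multiplicative (ℤ × ℤ))) ^ 6 = 1 := by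
  ext p : 1
  refine Multiplicative.toAdd.injective (Prod.ext ?_ ?_) <;>
    simp [pow_succ, ellG5]

theorem phiG5_ofAdd_six_mul (k : ℤ) : phiG5 (.ofAdd (6 * k)) = 1 := by
  rw [phiG5, zpowersHom_apply, toAdd_ofAdd, zpow_mul,
    show (6 : ℤ) = ((6 : ℕ) : ℤ) from rfl, zpow_natCast, ellG5_pow_six, one_zpow]

theorem six_dvd_of_phiG5_fixed {k m : ℤ} (hm : m ≠ 0)
    (h : phiG5 (.ofAdd k) (.ofAdd (m, 0)) = .ofAdd (m, 0)) : 6 ∣ k := by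
  rw [← Int.emod_add_mul_ediv k 6, ofAdd_add, map_mul, phiG5_ofAdd_six_mul, mul_one] at h
  have h0 := Int.emod_nonneg k (b := 6) (by norm_num)
  have h6 := Int.emod_lt_of_pos k (b := 6) (by norm_num)
  apply Int.dvd_of_emod_eq_zero
  obtain ⟨r, hr⟩ := Int.eq_ofNat_of_zero_le h0
  rw [hr] at h h6 ⊢
  have hr6 : r < 6 := by omega
  rw [phiG5, zpowersHom_apply, toAdd_ofAdd] at h
  have h1 := congrArg (fun p => p.toAdd.1) h
  have h2 := congrArg (fun p => p.toAdd.2) h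
  clear h
  interval_cases r <;> simp [pow_succ, ellG5] at h1 h2 ⊢ <;> omega

/-- The inclusion of the translation subgroup `ℤ² × 6ℤ` in `π₁(G₅)`. -/
def translationHom : Multiplicative ((ℤ × ℤ) × ℤ) →* PiG5 where
  toFun p := ⟨.ofAdd p.toAdd.1, .ofAdd (6 * p.toAdd.2)⟩
  map_one' := rfl
  map_mul' p q := by
    refine SemidirectProduct.ext ?_ (congrArg Multiplicative.ofAdd (mul_add 6 _ _))
    rw [SemidirectProduct.mul_left, phiG5_ofAdd_six_mul]
    rfl

theorem translationHom_injective : Function.Injective translationHom := by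
  intro p q h
  have h1 : p.toAdd.1 = q.toAdd.1 := congrArg (fun g : PiG5 => g.left.toAdd) h
  have h2 : 6 * p.toAdd.2 = 6 * q.toAdd.2 := congrArg (fun g : PiG5 => g.right.toAdd) h
  replace h2 := mul_left_cancel₀ (by norm_num) h2
  exact Multiplicative.toAdd.injective (Prod.ext h1 h2)

theorem mem_range_translationHom {g : PiG5} : g ∈ translationHom.range ↔ 6 ∣ g.right.toAdd := by
  constructor
  · rintro ⟨p, rfl⟩
    exact ⟨p.toAdd.2, rfl⟩
  · rintro ⟨k, hk⟩
    exact ⟨.ofAdd (g.left.toAdd, k), SemidirectProduct.ext rfl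
      (Multiplicative.toAdd.injective hk.symm)⟩

theorem index_range_translationHom : translationHom.range.index = 6 := by
  have : translationHom.range = (AddSubgroup.toSubgroup (AddSubgroup.zmultiples (6 : ℤ))).comap
      (SemidirectProduct.rightHom : PiG5 →* Multiplicative ℤ) := by
    ext g
    rw [mem_range_translationHom, Subgroup.mem_comap]
    exact Int.mem_zmultiples_iff.symm
  rw [this, Subgroup.index_comap_of_surjective _ SemidirectProduct.rightHom_surjective,
    AddSubgroup.index_toSubgroup, Int.index_zmultiples]
  rfl

theorem le_range_translationHom_of_commute {H : Subgroup PiG5} (hH : H.index ≠ 0)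
    (hcomm : ∀ g ∈ H, ∀ h ∈ H, g * h = h * g) : H ≤ translationHom.range := by
  intro g hg
  obtain ⟨m, hm, -, hmem⟩ := Subgroup.exists_pow_mem_of_index_ne_zero hH
    (SemidirectProduct.inl (.ofAdd ((1 : ℤ), (0 : ℤ))))
  rw [← map_pow, ← ofAdd_nsmul] at hmem
  have h := congrArg SemidirectProduct.left (hcomm g hg _ hmem)
  rw [mem_range_translationHom]
  refine six_dvd_of_phiG5_fixed (m := m) (by exact_mod_cast hm.ne') ?_
  simp [mul_comm] at h
  simpa using h

theorem index_and_nonempty_mulEquiv_iff {m : ℕ} (hm : 0 < m) (L : AddSubgroup ((ℤ × ℤ) × ℤ)) :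
    ((AddSubgroup.toSubgroup L).map translationHom).index = 6 * m ∧
      Nonempty ((AddSubgroup.toSubgroup L).map translationHom ≃* Z3) ↔ L.index = m := by
  rw [Subgroup.index_map_of_injective _ translationHom_injective, index_range_translationHom,
    AddSubgroup.index_toSubgroup]
  refine ⟨fun h => by omega, fun h => ⟨by omega, ?_⟩⟩
  obtain ⟨e⟩ := nonempty_mulEquiv_Z3 L (by omega)
  exact ⟨((AddSubgroup.toSubgroup L).equivMapOfInjective _ translationHom_injective).symm.trans e⟩

theorem exists_map_translationHom_eq {H : Subgroup PiG5} (hH : H.index ≠ 0)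
    (e : Nonempty (H ≃* Z3)) :
    ∃ L : AddSubgroup ((ℤ × ℤ) × ℤ), (AddSubgroup.toSubgroup L).map translationHom = H := by
  obtain ⟨e⟩ := e
  have hle : H ≤ translationHom.range := by
    refine le_range_translationHom_of_commute hH fun g hg h hh => ?_
    have : (⟨g, hg⟩ * ⟨h, hh⟩ : H) = ⟨h, hh⟩ * ⟨g, hg⟩ :=
      e.injective (by rw [map_mul, map_mul, mul_comm])
    exact congrArg Subtype.val this
  refine ⟨AddSubgroup.toSubgroup.symm (H.comap translationHom), ?_⟩
  rw [OrderIso.apply_symm_apply, Subgroup.map_comap_eq, inf_eq_right.2 hle]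

/-- the number of index-`n` subgroups of `π₁(G₅)` isomorphic to `ℤ³`. -/
theorem stmt9 (n : ℕ) (hn : 0 < n) :
    Nat.card {H : Subgroup PiG5 // H.index = n ∧ Nonempty (H ≃* Z3)} =
      (if 6 ∣ n then omegaFn (n / 6) else 0) := by
  split_ifs with h6
  · obtain ⟨m, rfl⟩ := h6
    have hm : 0 < m := by omega
    rw [Nat.mul_div_cancel_left m (by norm_num), ← card_addSubgroup_int_cubed_index hm]
    refine (Nat.card_congr (Equiv.ofBijective (fun L => ⟨_, (index_and_nonempty_mulEquiv_iff hm
      L.1).2 L.2⟩) ⟨fun L M h => ?_, fun H => ?_⟩)).symm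
    · have h := Subgroup.map_injective translationHom_injective (congrArg Subtype.val h)
      exact Subtype.ext (AddSubgroup.toSubgroup.injective h)
    · obtain ⟨L, hL⟩ := exists_map_translationHom_eq (by have := H.2.1; omega) H.2.2
      exact ⟨⟨L, (index_and_nonempty_mulEquiv_iff hm L).1 (hL ▸ H.2)⟩, Subtype.ext hL⟩
  · rw [Nat.card_eq_zero]
    refine Or.inl ⟨fun H => h6 ?_⟩
    obtain ⟨L, hL⟩ := exists_map_translationHom_eq (by have := H.2.1; omega) H.2.2
    rw [← H.2.1, ← hL, Subgroup.index_map_of_injective _ translationHom_injective,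
      index_range_translationHom]
    exact Dvd.intro_left _ rfl
end
end

section
/- For every positive integer n, the number of pairs (H, ν), where H is a subgroup of index n in ℤ² and ν is an element of the quotient group ℤ²/H satisfying 2ν = 0, equals σ₁(n) + 3·σ₁(n/2), where σ₁(n/2) is 0 when n is odd. -/
open scoped Classical

noncomputable section

/-- The index of a subgroup of `ℤ²` is the product of the indices of its projection to the first
coordinate and of its intersection with the second axis. -/
lemma index_eq_index_map_fst_mul_index_comap_inr (H : AddSubgroup (ℤ × ℤ)) :
    H.index = (H.map (AddMonoidHom.fst ℤ ℤ)).index * (H.comap (AddMonoidHom.inr ℤ ℤ)).index := by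
  have hker : (AddMonoidHom.fst ℤ ℤ).ker = (AddMonoidHom.inr ℤ ℤ).range := by
    ext ⟨x, y⟩
    rw [AddMonoidHom.mem_ker, AddMonoidHom.mem_range]
    simp [eq_comm]
  have hrange : (AddMonoidHom.fst ℤ ℤ).range = ⊤ :=
    AddMonoidHom.range_eq_top.2 Prod.fst_surjective
  rw [AddSubgroup.index_map, AddSubgroup.index_comap, hrange, AddSubgroup.index_top, mul_one,
    hker, ← AddSubgroup.relIndex_mul_index (le_sup_left : H ≤ H ⊔ (AddMonoidHom.inr ℤ ℤ).range),
    sup_comm, AddSubgroup.relIndex_sup_right, mul_comm]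

/-- The sublattice of `ℤ²` spanned by `(a, b)` and `(0, d)`. -/
def hermiteLattice (a d b : ℕ) : AddSubgroup (ℤ × ℤ) where
  carrier := {p | ∃ k : ℤ, p.1 = k * a ∧ (d : ℤ) ∣ p.2 - k * b}
  zero_mem' := ⟨0, by simp⟩
  add_mem' := by
    rintro p q ⟨k, hk, hk'⟩ ⟨l, hl, hl'⟩
    refine ⟨k + l, by simp [hk, hl, add_mul], ?_⟩
    refine (dvd_add hk' hl').trans (dvd_of_eq ?_)
    rw [Prod.snd_add]
    ring
  neg_mem' := by
    rintro p ⟨k, hk, hk'⟩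
    refine ⟨-k, by simp [hk], ?_⟩
    refine (dvd_neg.2 hk').trans (dvd_of_eq ?_)
    rw [Prod.snd_neg]
    ring

lemma mem_hermiteLattice {a d b : ℕ} {p : ℤ × ℤ} :
    p ∈ hermiteLattice a d b ↔ ∃ k : ℤ, p.1 = k * a ∧ (d : ℤ) ∣ p.2 - k * b := Iff.rfl

lemma map_fst_hermiteLattice (a d b : ℕ) :
    (hermiteLattice a d b).map (AddMonoidHom.fst ℤ ℤ) = AddSubgroup.zmultiples (a : ℤ) := by
  ext x
  simp only [AddSubgroup.mem_map, mem_hermiteLattice, AddSubgroup.mem_zmultiples_iff, smul_eq_mul]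
  constructor
  · rintro ⟨p, ⟨k, hk, -⟩, rfl⟩
    exact ⟨k, hk.symm⟩
  · rintro ⟨k, rfl⟩
    exact ⟨(k * a, k * b), ⟨k, by simp⟩, rfl⟩

lemma zero_prod_mem_hermiteLattice {a d b : ℕ} (ha : a ≠ 0) {y : ℤ} :
    (0, y) ∈ hermiteLattice a d b ↔ (d : ℤ) ∣ y := by
  simp [mem_hermiteLattice, ha]

lemma comap_inr_hermiteLattice {a : ℕ} (ha : a ≠ 0) (d b : ℕ) :
    (hermiteLattice a d b).comap (AddMonoidHom.inr ℤ ℤ) = AddSubgroup.zmultiples (d : ℤ) := by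
  ext y
  rw [AddSubgroup.mem_comap, Int.mem_zmultiples_iff]
  exact zero_prod_mem_hermiteLattice ha

lemma index_hermiteLattice {a : ℕ} (ha : a ≠ 0) (d b : ℕ) :
    (hermiteLattice a d b).index = a * d := by
  rw [index_eq_index_map_fst_mul_index_comap_inr, map_fst_hermiteLattice,
    comap_inr_hermiteLattice ha, Int.index_zmultiples, Int.index_zmultiples]
  simp

lemma hermiteLattice_inj {a d b a' d' b' : ℕ} (ha : a ≠ 0) (hb : b < d) (hb' : b' < d')
    (h : hermiteLattice a d b = hermiteLattice a' d' b') : a = a' ∧ d = d' ∧ b = b' := by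
  have haa : a = a' := by
    have := congrArg (fun H => (H.map (AddMonoidHom.fst ℤ ℤ)).index) h
    simpa [map_fst_hermiteLattice, Int.index_zmultiples] using this
  subst haa
  have hdd : d = d' := by
    have := congrArg (fun H => (H.comap (AddMonoidHom.inr ℤ ℤ)).index) h
    simpa [comap_inr_hermiteLattice ha, Int.index_zmultiples] using this
  subst hdd
  refine ⟨rfl, rfl, ?_⟩
  have hmem : ((a : ℤ), (b : ℤ)) ∈ hermiteLattice a d b' := h ▸ ⟨1, by simp⟩
  obtain ⟨k, hk, hk'⟩ := hmem
  obtain rfl : k = 1 := by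
    have : (a : ℤ) ≠ 0 := by exact_mod_cast ha
    exact mul_right_cancel₀ this (by linarith)
  have := Int.eq_zero_of_abs_lt_dvd hk' (by simp only; rw [abs_lt]; omega)
  simp only at this
  omega

lemma Int.exists_natCast_zmultiples (K : AddSubgroup ℤ) :
    ∃ a : ℕ, K = AddSubgroup.zmultiples (a : ℤ) := by
  obtain ⟨a, rfl⟩ := Int.subgroup_cyclic K
  exact ⟨a.natAbs, by rw [Int.zmultiples_natAbs, AddSubgroup.zmultiples_eq_closure]⟩

lemma exists_eq_hermiteLattice {H : AddSubgroup (ℤ × ℤ)} (hH : H.index ≠ 0) :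
    ∃ a d b : ℕ, a ≠ 0 ∧ b < d ∧ H = hermiteLattice a d b := by
  obtain ⟨a, ha⟩ := Int.exists_natCast_zmultiples (H.map (AddMonoidHom.fst ℤ ℤ))
  obtain ⟨d, hd⟩ := Int.exists_natCast_zmultiples (H.comap (AddMonoidHom.inr ℤ ℤ))
  rw [index_eq_index_map_fst_mul_index_comap_inr, ha, hd, Int.index_zmultiples,
    Int.index_zmultiples, Int.natAbs_natCast, Int.natAbs_natCast, mul_ne_zero_iff] at hH
  have hd0 : (0 : ℤ) < d := by exact_mod_cast Nat.pos_of_ne_zero hH.2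
  have hvert (y : ℤ) : (0, y) ∈ H ↔ (d : ℤ) ∣ y := by
    rw [← Int.mem_zmultiples_iff, ← hd, AddSubgroup.mem_comap]
    rfl
  obtain ⟨⟨x, c⟩, hc, hx⟩ : (a : ℤ) ∈ H.map (AddMonoidHom.fst ℤ ℤ) := by simp [ha]
  obtain rfl : x = a := hx
  obtain ⟨b, hb⟩ := Int.eq_ofNat_of_zero_le (Int.emod_nonneg c hd0.ne')
  have hbd : b < d := by have := Int.emod_lt_of_pos c hd0; omega
  have hab : ((a : ℤ), (b : ℤ)) ∈ H := by
    have h := H.sub_mem hc ((hvert (d * (c / d))).2 (dvd_mul_right _ _))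
    convert h using 1
    have := Int.emod_add_mul_ediv c d
    ext
    · simp
    · simp only [Prod.snd_sub]; omega
  refine ⟨a, d, b, hH.1, hbd, ?_⟩
  have key (k y : ℤ) : (k * a, y) ∈ H ↔ (d : ℤ) ∣ y - k * b := by
    rw [← hvert, ← H.add_mem_cancel_right (H.zsmul_mem hab k) (y := (0, y - k * b))]
    simp
  ext ⟨x, y⟩
  rw [mem_hermiteLattice]
  constructor
  · intro h
    have hx : x ∈ H.map (AddMonoidHom.fst ℤ ℤ) := ⟨_, h, rfl⟩
    rw [ha, AddSubgroup.mem_zmultiples_iff] at hx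
    obtain ⟨k, rfl⟩ := hx
    exact ⟨k, rfl, (key k y).1 h⟩
  · rintro ⟨k, hk, hy⟩
    simp only at hk hy
    subst hk
    exact (key k y).2 hy

/-- Subgroups of index `n` in `ℤ²` are parametrised by their Hermite normal forms. -/
def hermiteEquiv {n : ℕ} (hn : n ≠ 0) :
    (Σ x : n.divisorsAntidiagonal, Fin x.1.2) ≃ {H : AddSubgroup (ℤ × ℤ) // H.index = n} :=
  Equiv.ofBijective
    (fun x => ⟨hermiteLattice x.1.1.1 x.1.1.2 x.2, by
      obtain ⟨h, -⟩ := Nat.mem_divisorsAntidiagonal.1 x.1.2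
      rw [index_hermiteLattice (left_ne_zero_of_mul (h.trans_ne hn)), h]⟩) <| by
    constructor
    · rintro ⟨⟨⟨a, d⟩, h⟩, b, hb⟩ ⟨⟨⟨a', d'⟩, h'⟩, b', hb'⟩ heq
      obtain ⟨had, -⟩ := Nat.mem_divisorsAntidiagonal.1 h
      obtain ⟨rfl, rfl, rfl⟩ := hermiteLattice_inj (left_ne_zero_of_mul (had.trans_ne hn)) hb hb'
        (congrArg Subtype.val heq)
      rfl
    · rintro ⟨H, rfl⟩
      obtain ⟨a, d, b, ha, hb, rfl⟩ := exists_eq_hermiteLattice hn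
      exact ⟨⟨⟨(a, d), Nat.mem_divisorsAntidiagonal.2 ⟨(index_hermiteLattice ha d b).symm, hn⟩⟩,
        ⟨b, hb⟩⟩, rfl⟩

lemma two_nsmul_mk_hermiteLattice_eq_zero_iff {a d b : ℕ} (p : ℤ × ℤ) :
    2 • (p : (ℤ × ℤ) ⧸ hermiteLattice a d b) = 0 ↔
      ∃ k : ℤ, 2 * p.1 = k * a ∧ (d : ℤ) ∣ 2 * p.2 - k * b := by
  rw [← QuotientAddGroup.mk_nsmul, QuotientAddGroup.eq_zero_iff, mem_hermiteLattice]
  simp [two_mul]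

lemma mk_hermiteLattice_eq_iff {a d b : ℕ} (p q : ℤ × ℤ) :
    (p : (ℤ × ℤ) ⧸ hermiteLattice a d b) = q ↔
      ∃ k : ℤ, q.1 - p.1 = k * a ∧ (d : ℤ) ∣ q.2 - p.2 - k * b := by
  rw [QuotientAddGroup.eq, mem_hermiteLattice]
  simp [neg_add_eq_sub]

lemma Fin.eq_of_dvd_sub {d : ℕ} {y z : Fin d} (h : (d : ℤ) ∣ (z : ℤ) - y) : y = z := by
  have := Int.eq_zero_of_abs_lt_dvd h (by rw [abs_lt]; omega)
  omega

lemma Fin.exists_dvd_sub {d : ℕ} (hd : d ≠ 0) (x : ℤ) : ∃ z : Fin d, (d : ℤ) ∣ (z : ℤ) - x := by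
  have hd0 : (0 : ℤ) < d := by exact_mod_cast Nat.pos_of_ne_zero hd
  obtain ⟨z, hz⟩ := Int.eq_ofNat_of_zero_le (Int.emod_nonneg x hd0.ne')
  refine ⟨⟨z, by have := Int.emod_lt_of_pos x hd0; omega⟩, ?_⟩
  have := Int.emod_add_mul_ediv x d
  exact ⟨-(x / d), by simp only; linarith⟩

/-- A 2-torsion class modulo `hermiteLattice a d b` has a unique representative `(0, y)` or
`(a / 2, y)` with `0 ≤ y < d`. -/
lemma card_two_torsion_hermiteLattice {a d b : ℕ} (ha : a ≠ 0) (hd : d ≠ 0) :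
    Nat.card {ν : (ℤ × ℤ) ⧸ hermiteLattice a d b // 2 • ν = 0} =
      Nat.card {y : Fin d // d ∣ 2 * y.1} +
        Nat.card {y : Fin d // 2 ∣ a ∧ (d : ℤ) ∣ 2 * y.1 - b} := by
  rw [← Nat.card_sum]
  symm
  have ha' : (a : ℤ) ≠ 0 := by exact_mod_cast ha
  let f : {y : Fin d // d ∣ 2 * y.1} ⊕ {y : Fin d // 2 ∣ a ∧ (d : ℤ) ∣ 2 * y.1 - b} →
      {ν : (ℤ × ℤ) ⧸ hermiteLattice a d b // 2 • ν = 0} :=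
    Sum.elim
      (fun y => ⟨((0, (y.1 : ℤ)) : ℤ × ℤ), (two_nsmul_mk_hermiteLattice_eq_zero_iff _).2
        ⟨0, by simp, by simpa using Int.natCast_dvd_natCast.2 y.2⟩⟩)
      (fun y => ⟨(((a / 2 : ℕ), (y.1 : ℤ)) : ℤ × ℤ), (two_nsmul_mk_hermiteLattice_eq_zero_iff _).2
        ⟨1, by have := y.2.1; simp only; omega, by simpa using y.2.2⟩⟩)
  refine Nat.card_congr (Equiv.ofBijective f ⟨?_, ?_⟩)
  · have hne (k : ℤ) (h2 : 2 ∣ a) : ((a / 2 : ℕ) : ℤ) ≠ k * a := by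
      obtain ⟨c, rfl⟩ := h2
      intro h
      rw [Nat.mul_div_cancel_left c two_pos] at h
      push_cast at h ha'
      have h1 : (c : ℤ) * 1 = c * (2 * k) := by linarith
      have := mul_left_cancel₀ (right_ne_zero_of_mul ha') h1
      omega
    rintro (y | y) (z | z) h <;>
      obtain ⟨k, hk, hk'⟩ := (mk_hermiteLattice_eq_iff _ _).1 (congrArg Subtype.val h)
    · obtain rfl : k = 0 := by simpa [ha] using hk
      exact congrArg Sum.inl (Subtype.ext (Fin.eq_of_dvd_sub (by simpa using hk')))
    · exact (hne k z.2.1 (by simpa using hk)).elim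
    · refine (hne (-k) y.2.1 ?_).elim
      simp only at hk
      linarith
    · obtain rfl : k = 0 := by simpa [ha] using hk
      exact congrArg Sum.inr (Subtype.ext (Fin.eq_of_dvd_sub (by simpa using hk')))
  · rintro ⟨ν, hν⟩
    obtain ⟨⟨x, y⟩, rfl⟩ := QuotientAddGroup.mk_surjective ν
    obtain ⟨k, hk, hk'⟩ := (two_nsmul_mk_hermiteLattice_eq_zero_iff _).1 hν
    simp only at hk hk'
    obtain ⟨m, rfl | rfl⟩ := Int.even_or_odd' k
    · obtain ⟨z, hz⟩ := Fin.exists_dvd_sub hd (y - m * b)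
      refine ⟨Sum.inl ⟨z, ?_⟩, Subtype.ext ((mk_hermiteLattice_eq_iff _ _).2 ⟨m, ?_, ?_⟩)⟩
      · rw [← Int.natCast_dvd_natCast]
        exact (dvd_add hk' (hz.mul_left 2)).trans (dvd_of_eq (by push_cast; ring))
      · simp only
        linarith
      · exact (dvd_neg.2 hz).trans (dvd_of_eq (by ring))
    · obtain ⟨z, hz⟩ := Fin.exists_dvd_sub hd (y - m * b)
      have h2 : 2 ∣ a := by
        have : (2 : ℤ) ∣ a := ⟨x - m * a, by linarith⟩
        exact_mod_cast this
      refine ⟨Sum.inr ⟨z, h2, ?_⟩, Subtype.ext ((mk_hermiteLattice_eq_iff _ _).2 ⟨m, ?_, ?_⟩)⟩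
      · exact (dvd_add hk' (hz.mul_left 2)).trans (dvd_of_eq (by ring))
      · have : (2 : ℤ) * (a / 2 : ℕ) = a := by exact_mod_cast Nat.mul_div_cancel' h2
        simp only
        linarith
      · exact (dvd_neg.2 hz).trans (dvd_of_eq (by ring))

lemma card_fin_dvd_two_mul {d : ℕ} (hd : d ≠ 0) :
    Nat.card {y : Fin d // d ∣ 2 * y.1} = if 2 ∣ d then 2 else 1 := by
  have hdvd (y : Fin d) : d ∣ 2 * y.1 ↔ y.1 = 0 ∨ 2 * y.1 = d := by
    constructor
    · rintro ⟨k, hk⟩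
      have hk2 : k < 2 := by
        by_contra! h
        have := Nat.mul_le_mul_left d h
        omega
      interval_cases k <;> omega
    · rintro (h | h) <;> simp [h]
  rw [Nat.card_eq_fintype_card, Fintype.card_subtype]
  simp only [hdvd]
  split_ifs with h
  · obtain ⟨c, rfl⟩ := h
    rw [Finset.card_eq_two]
    refine ⟨⟨0, by omega⟩, ⟨c, by omega⟩, by simp [Fin.ext_iff]; omega, ?_⟩
    ext y
    simp [Fin.ext_iff]
  · rw [Finset.card_eq_one]
    refine ⟨⟨0, by omega⟩, ?_⟩
    ext y
    simp only [Finset.mem_filter, Finset.mem_univ, true_and, Finset.mem_singleton, Fin.ext_iff]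
    omega

lemma sum_card_fin_dvd_two_mul_sub {d : ℕ} (hd : d ≠ 0) (a : ℕ) :
    ∑ b : Fin d, Nat.card {y : Fin d // 2 ∣ a ∧ (d : ℤ) ∣ 2 * y.1 - b.1} =
      if 2 ∣ a then d else 0 := by
  split_ifs with h
  · simp only [h, true_and]
    rw [← Nat.card_sigma]
    refine (Nat.card_congr (Equiv.ofBijective (fun p => p.2.1) ⟨?_, ?_⟩)).trans (Nat.card_fin d)
    · rintro ⟨b, y, hy⟩ ⟨b', y', hy'⟩ hyy
      obtain rfl : y = y' := hyy
      obtain rfl : b = b' := Fin.eq_of_dvd_sub ((dvd_sub hy hy').trans (dvd_of_eq (by ring)))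
      rfl
    · intro y
      obtain ⟨b, hb⟩ := Fin.exists_dvd_sub hd (2 * y.1)
      exact ⟨⟨b, y, dvd_sub_comm.1 hb⟩, rfl⟩
  · simp [h]

lemma sum_divisors_filter_two_dvd {n : ℕ} (hn : n ≠ 0) :
    ∑ d ∈ n.divisors with 2 ∣ d, d = 2 * (if 2 ∣ n then sigma1 (n / 2) else 0) := by
  split_ifs with h
  · obtain ⟨m, rfl⟩ := h
    rw [Nat.mul_div_cancel_left m two_pos, sigma1, Finset.mul_sum]
    symm
    refine Finset.sum_bij (fun d _ => 2 * d) ?_ ?_ ?_ (fun _ _ => rfl)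
    · intro d hd
      simpa [Nat.mul_dvd_mul_iff_left] using hd
    · intro d _ e _ h
      simpa using h
    · intro d hd
      obtain ⟨hd, c, rfl⟩ := Finset.mem_filter.1 hd
      exact ⟨c, by simpa [Nat.mul_dvd_mul_iff_left] using hd, rfl⟩
  · rw [mul_zero, Finset.filter_eq_empty_iff.2, Finset.sum_empty]
    exact fun d hd h2 => h (h2.trans (Nat.dvd_of_mem_divisors hd))

lemma sum_divisors_filter_two_dvd_div {n : ℕ} (hn : n ≠ 0) :
    ∑ d ∈ n.divisors with 2 ∣ n / d, d = if 2 ∣ n then sigma1 (n / 2) else 0 := by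
  split_ifs with h
  · obtain ⟨m, rfl⟩ := h
    rw [Nat.mul_div_cancel_left m two_pos, sigma1]
    congr 1
    ext d
    simp only [Finset.mem_filter, Nat.mem_divisors]
    constructor
    · rintro ⟨⟨hd, -⟩, h2⟩
      exact ⟨Nat.dvd_of_mul_dvd_mul_left two_pos
        (mul_comm d 2 ▸ (Nat.dvd_div_iff_mul_dvd hd).1 h2), right_ne_zero_of_mul hn⟩
    · rintro ⟨hd, -⟩
      have hd' : d ∣ 2 * m := hd.mul_left 2
      exact ⟨⟨hd', hn⟩, (Nat.dvd_div_iff_mul_dvd hd').2 (mul_comm 2 d ▸ mul_dvd_mul_left 2 hd)⟩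
  · rw [Finset.filter_eq_empty_iff.2, Finset.sum_empty]
    exact fun d hd h2 => h (h2.trans (Nat.div_dvd_of_dvd (Nat.dvd_of_mem_divisors hd)))

/-- the number of pairs `(H, ν)` with `H ≤ ℤ²` of index `n` and
`ν ∈ ℤ²/H` with `2ν = 0` equals `σ₁(n) + 3σ₁(n/2)`. -/
theorem stmt16 (n : ℕ) (hn : 0 < n) :
    Nat.card {p : Σ H : AddSubgroup (ℤ × ℤ), (ℤ × ℤ) ⧸ H //
        p.1.index = n ∧ 2 • p.2 = 0} =
      sigma1 n + 3 * (if 2 ∣ n then sigma1 (n / 2) else 0) := by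
  let e : {p : Σ H : AddSubgroup (ℤ × ℤ), (ℤ × ℤ) ⧸ H // p.1.index = n ∧ 2 • p.2 = 0} ≃
      Σ H : {H : AddSubgroup (ℤ × ℤ) // H.index = n}, {ν : (ℤ × ℤ) ⧸ H.1 // 2 • ν = 0} :=
    { toFun p := ⟨⟨p.1.1, p.2.1⟩, ⟨p.1.2, p.2.2⟩⟩
      invFun q := ⟨⟨q.1.1, q.2.1⟩, q.1.2, q.2.2⟩
      left_inv _ := rfl
      right_inv _ := rfl }
  have hfin (H : {H : AddSubgroup (ℤ × ℤ) // H.index = n}) : Finite ((ℤ × ℤ) ⧸ H.1) :=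
    have : H.1.FiniteIndex := ⟨by rw [H.2]; exact hn.ne'⟩
    AddSubgroup.finite_quotient_of_finiteIndex
  have : Finite {H : AddSubgroup (ℤ × ℤ) // H.index = n} := Finite.of_equiv _ (hermiteEquiv hn.ne')
  have := Fintype.ofFinite {H : AddSubgroup (ℤ × ℤ) // H.index = n}
  rw [Nat.card_congr e, Nat.card_sigma, ← (hermiteEquiv hn.ne').sum_comp, Fintype.sum_sigma]
  have hsum (x : n.divisorsAntidiagonal) :
      ∑ b : Fin x.1.2, Nat.card {ν : (ℤ × ℤ) ⧸ (hermiteEquiv hn.ne' ⟨x, b⟩).1 // 2 • ν = 0} =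
        x.1.2 + ((if 2 ∣ x.1.2 then x.1.2 else 0) + if 2 ∣ x.1.1 then x.1.2 else 0) := by
    obtain ⟨⟨a, d⟩, h⟩ := x
    obtain ⟨rfl, -⟩ := Nat.mem_divisorsAntidiagonal.1 h
    obtain ⟨ha, hd⟩ := mul_ne_zero_iff.1 hn.ne'
    refine (Finset.sum_congr rfl fun b _ => card_two_torsion_hermiteLattice ha hd).trans ?_
    rw [Finset.sum_add_distrib, sum_card_fin_dvd_two_mul_sub hd, card_fin_dvd_two_mul hd]
    simp only [Finset.sum_const, Finset.card_univ, Fintype.card_fin, smul_eq_mul]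
    split_ifs <;> ring
  rw [Finset.sum_congr rfl fun x _ => hsum x,
    Finset.sum_coe_sort n.divisorsAntidiagonal (fun x : ℕ × ℕ =>
      x.2 + ((if 2 ∣ x.2 then x.2 else 0) + if 2 ∣ x.1 then x.2 else 0)),
    Nat.sum_divisorsAntidiagonal' (fun x y =>
      y + ((if 2 ∣ y then y else 0) + if 2 ∣ x then y else 0)),
    Finset.sum_add_distrib, Finset.sum_add_distrib, ← Finset.sum_filter, ← Finset.sum_filter,
    sum_divisors_filter_two_dvd hn.ne', sum_divisors_filter_two_dvd_div hn.ne', ← sigma1]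
  ring
end
end
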